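/- arXiv:1908.04033 — 2 statements merged into one kernel-verified Lean document; each statement's English description precedes it below -/
import Mathlib

section
/- Fix an integer d ≥ 2 and let n → ∞. Then the random variable Y_n = n·(Γ(d/2)/(2√π Γ((d+1)/2)))·(1−H_typ²)^{(d−1)/2} converges in distribution to a Gamma(d−1) random variable (density e^{−t} t^{d−2}/Γ(d−1) on (0,∞)). Concretely, for every t > 0, writing h_t(n) = √(1 − (2√π Γ((d+1)/2) t/(n Γ(d/2)))^{2/(d−1)}) (well defined for n large), one has [I(n,d,−1,−h_t(n)) + I(n,d,h_t(n),1)]/I(n,d,−1,1) → (1/Γ(d−1)) ∫_0^t s^{d−2} e^{−s} ds as n → ∞. -/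
open Filter

noncomputable def c1 (d : ℕ) : ℝ :=
  Real.Gamma ((d : ℝ) / 2) / (Real.sqrt Real.pi * Real.Gamma (((d : ℝ) - 1) / 2))

noncomputable def c2 (d : ℕ) : ℝ :=
  Real.Gamma (((d : ℝ) ^ 2 - 2 * (d : ℝ) + 2) / 2) /
    (Real.sqrt Real.pi * Real.Gamma (((d : ℝ) ^ 2 - 2 * (d : ℝ) + 1) / 2))

/-- `II n d a b` is the integral `I(n,d,a,b)` from the paper. -/
noncomputable def II (n d : ℕ) (a b : ℝ) : ℝ :=
  ∫ h in a..b, (1 - h ^ 2) ^ (((d : ℝ) ^ 2 - 2 * (d : ℝ) - 1) / 2) *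
    (c1 d * ∫ s in (-1 : ℝ)..h, (1 - s ^ 2) ^ (((d : ℝ) - 3) / 2)) ^ (n - d)

/-- `FF n d a b` is the expected number of facets with height in `[a,b]`. -/
noncomputable def FF (n d : ℕ) (a b : ℝ) : ℝ :=
  (n.choose d : ℝ) * 2 * c2 d * II n d a b

/-- The standard normal CDF. -/
noncomputable def stdPhi (r : ℝ) : ℝ :=
  (Real.sqrt (2 * Real.pi))⁻¹ * ∫ s in Set.Iic r, Real.exp (-s ^ 2 / 2)

open MeasureTheory Set intervalIntegral
open scoped Topology

theorem integral_rpow_mul_one_sub_rpow {u v : ℝ} (hu : 0 < u) (hv : 0 < v) :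
    ∫ x in (0 : ℝ)..1, x ^ (u - 1) * (1 - x) ^ (v - 1) =
      Real.Gamma u * Real.Gamma v / Real.Gamma (u + v) := by
  have h := ProbabilityTheory.beta_eq_betaIntegralReal u v hu hv
  rw [ProbabilityTheory.beta] at h
  have hcast : Complex.betaIntegral u v =
      ((∫ x in (0 : ℝ)..1, x ^ (u - 1) * (1 - x) ^ (v - 1) : ℝ) : ℂ) := by
    rw [Complex.betaIntegral, ← intervalIntegral.integral_ofReal]
    refine intervalIntegral.integral_congr fun x hx => ?_
    rw [uIcc_of_le zero_le_one] at hx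
    simp only [Complex.ofReal_mul, Complex.ofReal_cpow hx.1,
      Complex.ofReal_cpow (sub_nonneg.2 hx.2), Complex.ofReal_sub, Complex.ofReal_one]
  rw [h, hcast, Complex.ofReal_re]

theorem integral_one_sub_sq_rpow {a : ℝ} (ha : 0 < a) :
    ∫ s in (-1 : ℝ)..1, (1 - s ^ 2) ^ (a - 1) =
      √Real.pi * Real.Gamma a / Real.Gamma (a + 1 / 2) := by
  have hsub := intervalIntegral.integral_comp_mul_add (a := 0) (b := 1)
    (fun s : ℝ => (1 - s ^ 2) ^ (a - 1)) (two_ne_zero : (2 : ℝ) ≠ 0) (-1)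
  norm_num at hsub
  have hpt : ∫ x in (0 : ℝ)..1, (1 - (2 * x + -1) ^ 2) ^ (a - 1) =
      (4 : ℝ) ^ (a - 1) * (Real.Gamma a * Real.Gamma a / Real.Gamma (a + a)) := by
    rw [← integral_rpow_mul_one_sub_rpow ha ha, ← intervalIntegral.integral_const_mul]
    refine intervalIntegral.integral_congr fun x hx => ?_
    rw [uIcc_of_le zero_le_one] at hx
    have h1 : 0 ≤ 1 - x := sub_nonneg.2 hx.2
    rw [← Real.mul_rpow hx.1 h1, ← Real.mul_rpow (by norm_num) (mul_nonneg hx.1 h1)]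
    ring_nf
  rw [hpt] at hsub
  have hdup := Real.Gamma_mul_Gamma_add_half a
  have hpow : (2 : ℝ) ^ (1 - 2 * a) * (4 : ℝ) ^ (a - 1) = 1 / 2 := by
    rw [show (4 : ℝ) = 2 ^ (2 : ℝ) by norm_num, ← Real.rpow_mul (by norm_num),
      ← Real.rpow_add (by norm_num), show 1 - 2 * a + 2 * (a - 1) = -1 by ring,
      Real.rpow_neg_one]
    norm_num
  have g1 := (Real.Gamma_pos_of_pos ha).ne'
  have g2 := (Real.Gamma_pos_of_pos (show 0 < a + 1 / 2 by positivity)).ne'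
  have g3 := (Real.Gamma_pos_of_pos (show 0 < 2 * a by positivity)).ne'
  rw [← two_mul] at hsub
  rw [eq_div_iff g2]
  have hI : ∫ s in (-1 : ℝ)..1, (1 - s ^ 2) ^ (a - 1) =
      2 * ((4 : ℝ) ^ (a - 1) * (Real.Gamma a * Real.Gamma a / Real.Gamma (2 * a))) := by
    linarith
  rw [hI]
  calc _ = 2 * (4 : ℝ) ^ (a - 1) * Real.Gamma a / Real.Gamma (2 * a) *
        (Real.Gamma a * Real.Gamma (a + 1 / 2)) := by ring
    _ = 2 * ((2 : ℝ) ^ (1 - 2 * a) * (4 : ℝ) ^ (a - 1)) * Real.Gamma a * √Real.pi := by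
        rw [hdup]; field_simp
    _ = _ := by rw [hpow]; ring

theorem intervalIntegrable_one_sub_sq_rpow {a : ℝ} (ha : 0 < a) :
    IntervalIntegrable (fun s : ℝ => (1 - s ^ 2) ^ (a - 1)) volume (-1) 1 := by
  refine intervalIntegrable_of_integral_ne_zero ?_
  rw [integral_one_sub_sq_rpow ha]
  have g1 := Real.Gamma_pos_of_pos ha
  have g2 := Real.Gamma_pos_of_pos (show 0 < a + 1 / 2 by positivity)
  positivity

/-- The normalization making `(1 - s ^ 2) ^ (a - 1)` a probability density on `[-1, 1]`. -/
noncomputable def capConst (a : ℝ) : ℝ :=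
  Real.Gamma (a + 1 / 2) / (√Real.pi * Real.Gamma a)

/-- The distribution function of the density proportional to `(1 - s ^ 2) ^ (a - 1)`. -/
noncomputable def capCDF (a h : ℝ) : ℝ :=
  capConst a * ∫ s in (-1 : ℝ)..h, (1 - s ^ 2) ^ (a - 1)

theorem capConst_pos {a : ℝ} (ha : 0 < a) : 0 < capConst a := by
  have g1 := Real.Gamma_pos_of_pos ha
  have g2 := Real.Gamma_pos_of_pos (show 0 < a + 1 / 2 by positivity)
  unfold capConst
  positivity

theorem one_sub_sq_rpow_nonneg {p h : ℝ} (hl : -1 ≤ h) (hr : h ≤ 1) : 0 ≤ (1 - h ^ 2) ^ p :=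
  Real.rpow_nonneg (by nlinarith) _

theorem intervalIntegrable_one_sub_sq_rpow_of_mem {a x y : ℝ} (ha : 0 < a)
    (hx : x ∈ Icc (-1 : ℝ) 1) (hy : y ∈ Icc (-1 : ℝ) 1) :
    IntervalIntegrable (fun s : ℝ => (1 - s ^ 2) ^ (a - 1)) volume x y :=
  (intervalIntegrable_one_sub_sq_rpow ha).mono_set <| by
    rw [uIcc_of_le (by norm_num : (-1 : ℝ) ≤ 1)]
    exact uIcc_subset_Icc hx hy

theorem capCDF_eq_one_sub {a h : ℝ} (ha : 0 < a) (hh : h ∈ Icc (-1 : ℝ) 1) :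
    capCDF a h = 1 - capConst a * ∫ s in h..1, (1 - s ^ 2) ^ (a - 1) := by
  have hadd := integral_add_adjacent_intervals
    (intervalIntegrable_one_sub_sq_rpow_of_mem ha (left_mem_Icc.2 (by norm_num)) hh)
    (intervalIntegrable_one_sub_sq_rpow_of_mem ha hh (right_mem_Icc.2 (by norm_num)))
  have hone : capConst a * ∫ s in (-1 : ℝ)..1, (1 - s ^ 2) ^ (a - 1) = 1 := by
    rw [integral_one_sub_sq_rpow ha, capConst]
    have g1 := Real.Gamma_pos_of_pos ha
    have g2 := Real.Gamma_pos_of_pos (show 0 < a + 1 / 2 by positivity)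
    field_simp
  rw [← hadd, mul_add] at hone
  rw [capCDF]
  linarith

theorem capCDF_nonneg {a h : ℝ} (ha : 0 < a) (hh : h ∈ Icc (-1 : ℝ) 1) : 0 ≤ capCDF a h :=
  mul_nonneg (capConst_pos ha).le <| intervalIntegral.integral_nonneg hh.1 fun _ hs =>
    one_sub_sq_rpow_nonneg hs.1 (hs.2.trans hh.2)

theorem capCDF_mono {a x y : ℝ} (ha : 0 < a) (hx : -1 ≤ x) (hxy : x ≤ y) (hy : y ≤ 1) :
    capCDF a x ≤ capCDF a y := by
  refine mul_le_mul_of_nonneg_left ?_ (capConst_pos ha).le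
  have hx' : x ∈ Icc (-1 : ℝ) 1 := ⟨hx, hxy.trans hy⟩
  have hadd := integral_add_adjacent_intervals
    (intervalIntegrable_one_sub_sq_rpow_of_mem ha (left_mem_Icc.2 (by norm_num)) hx')
    (intervalIntegrable_one_sub_sq_rpow_of_mem ha hx' ⟨hx.trans hxy, hy⟩)
  rw [← hadd, le_add_iff_nonneg_right]
  exact intervalIntegral.integral_nonneg hxy fun _ hs =>
    one_sub_sq_rpow_nonneg (hx.trans hs.1) (hs.2.trans hy)

theorem continuousOn_capCDF {a : ℝ} (ha : 0 < a) : ContinuousOn (capCDF a) (Icc (-1) 1) := by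
  have h := continuousOn_primitive_interval' (intervalIntegrable_one_sub_sq_rpow ha) left_mem_uIcc
  rw [uIcc_of_le (by norm_num : (-1 : ℝ) ≤ 1)] at h
  exact continuousOn_const.mul h

theorem integral_mul_one_sub_sq_rpow {a h : ℝ} (ha : 0 < a) (h0 : 0 < h) (h1 : h < 1) :
    IntervalIntegrable (fun s : ℝ => s * (1 - s ^ 2) ^ (a - 1)) volume h 1 ∧
    ∫ s in h..1, s * (1 - s ^ 2) ^ (a - 1) = (1 - h ^ 2) ^ a / (2 * a) := by
  have hint : IntervalIntegrable (fun s : ℝ => s * (1 - s ^ 2) ^ (a - 1)) volume h 1 :=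
    (intervalIntegrable_one_sub_sq_rpow_of_mem ha ⟨by linarith, h1.le⟩
      (right_mem_Icc.2 (by norm_num))).continuousOn_mul continuousOn_id
  refine ⟨hint, ?_⟩
  rw [integral_eq_sub_of_hasDerivAt_of_le (f := fun s => -((1 - s ^ 2) ^ a / (2 * a))) h1.le ?_ ?_
    hint]
  · simp [Real.zero_rpow ha.ne']
  · refine ContinuousOn.neg (ContinuousOn.div_const (ContinuousOn.rpow_const (by fun_prop) ?_) _)
    exact fun _ _ => Or.inr ha.le
  · intro s hs
    have hpos : 0 < 1 - s ^ 2 := by nlinarith [hs.1, hs.2]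
    have hd : HasDerivAt (fun s : ℝ => 1 - s ^ 2) (-(2 * s)) s := by
      simpa using (hasDerivAt_pow 2 s).const_sub 1
    convert! ((hd.rpow_const (p := a) (Or.inl hpos.ne')).div_const (2 * a)).neg using 1
    field_simp

theorem capCDF_le {a h : ℝ} (ha : 0 < a) (h0 : 0 < h) (h1 : h < 1) :
    capCDF a h ≤ 1 - capConst a / (2 * a) * (1 - h ^ 2) ^ a := by
  rw [capCDF_eq_one_sub ha ⟨by linarith, h1.le⟩, div_mul_eq_mul_div, mul_div_assoc,
    ← (integral_mul_one_sub_sq_rpow ha h0 h1).2]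
  gcongr
  · exact (capConst_pos ha).le
  refine integral_mono_on h1.le (integral_mul_one_sub_sq_rpow ha h0 h1).1
    (intervalIntegrable_one_sub_sq_rpow_of_mem ha ⟨by linarith, h1.le⟩
      (right_mem_Icc.2 (by norm_num))) fun s hs => ?_
  exact mul_le_of_le_one_left (one_sub_sq_rpow_nonneg (by linarith [hs.1]) hs.2) hs.2

theorem le_capCDF {a h : ℝ} (ha : 0 < a) (h0 : 0 < h) (h1 : h < 1) :
    1 - capConst a / (2 * a) * (1 - h ^ 2) ^ a / h ≤ capCDF a h := by
  rw [capCDF_eq_one_sub ha ⟨by linarith, h1.le⟩, div_mul_eq_mul_div, mul_div_assoc,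
    ← (integral_mul_one_sub_sq_rpow ha h0 h1).2, mul_div_assoc]
  gcongr
  · exact (capConst_pos ha).le
  rw [← intervalIntegral.integral_div]
  refine integral_mono_on h1.le
    (intervalIntegrable_one_sub_sq_rpow_of_mem ha ⟨by linarith, h1.le⟩
      (right_mem_Icc.2 (by norm_num)))
    ((integral_mul_one_sub_sq_rpow ha h0 h1).1.div_const h) fun s hs => ?_
  rw [mul_div_right_comm]
  exact le_mul_of_one_le_left (one_sub_sq_rpow_nonneg (by linarith [hs.1]) hs.2)
    ((one_le_div h0).2 hs.1)

/-- The height `h` at which `(1 - h ^ 2) ^ a` equals `w`. -/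
noncomputable def capHeight (a w : ℝ) : ℝ := √(1 - w ^ (1 / a))

theorem capHeight_sq {a w : ℝ} (ha : 0 < a) (h0 : 0 ≤ w) (h1 : w ≤ 1) :
    1 - capHeight a w ^ 2 = w ^ (1 / a) := by
  rw [capHeight, Real.sq_sqrt (sub_nonneg.2 (Real.rpow_le_one h0 h1 (by positivity)))]
  ring

theorem one_sub_capHeight_sq_rpow {a w : ℝ} (ha : 0 < a) (h0 : 0 ≤ w) (h1 : w ≤ 1) :
    (1 - capHeight a w ^ 2) ^ a = w := by
  rw [capHeight_sq ha h0 h1, ← Real.rpow_mul h0, one_div_mul_cancel ha.ne', Real.rpow_one]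

theorem capHeight_pos {a w : ℝ} (ha : 0 < a) (h0 : 0 ≤ w) (h1 : w < 1) : 0 < capHeight a w :=
  Real.sqrt_pos.2 (sub_pos.2 (Real.rpow_lt_one h0 h1 (by positivity)))

theorem capHeight_lt_one {a w : ℝ} (h0 : 0 < w) : capHeight a w < 1 := by
  rw [capHeight, Real.sqrt_lt' one_pos]
  linarith [Real.rpow_pos_of_pos h0 (1 / a)]

theorem half_le_capHeight {a w : ℝ} (ha : 0 < a) (h0 : 0 ≤ w) (h1 : w ≤ (3 / 4) ^ a) :
    1 / 2 ≤ capHeight a w := by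
  refine Real.le_sqrt_of_sq_le ?_
  have h := Real.rpow_le_rpow h0 h1 (show 0 ≤ 1 / a by positivity)
  rw [← Real.rpow_mul (by norm_num), mul_one_div_cancel ha.ne', Real.rpow_one] at h
  linarith

theorem capHeight_three_quarters_rpow {a : ℝ} (ha : 0 < a) :
    capHeight a ((3 / 4) ^ a) = 1 / 2 := by
  rw [capHeight, ← Real.rpow_mul (by norm_num), mul_one_div_cancel ha.ne', Real.rpow_one,
    show (1 : ℝ) - 3 / 4 = (1 / 2) ^ 2 by norm_num, Real.sqrt_sq (by norm_num)]

theorem continuous_capHeight {a : ℝ} (ha : 0 < a) : Continuous (capHeight a) :=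
  Real.continuous_sqrt.comp
    (continuous_const.sub (continuous_id.rpow_const fun _ => Or.inr (by positivity)))

theorem capHeight_zero {a : ℝ} (ha : 0 < a) : capHeight a 0 = 1 := by
  rw [capHeight, Real.zero_rpow (by positivity), sub_zero, Real.sqrt_one]

theorem capHeight_image {a W : ℝ} (ha : 0 < a) (h0 : 0 < W) (h1 : W ≤ 1) :
    capHeight a '' Ioo 0 W = Ioo (capHeight a W) 1 := by
  ext h
  constructor
  · rintro ⟨w, hw, rfl⟩
    refine ⟨Real.sqrt_lt_sqrt ?_ ?_, capHeight_lt_one hw.1⟩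
    · exact sub_nonneg.2 (Real.rpow_le_one h0.le h1 (by positivity))
    · exact sub_lt_sub_left (Real.rpow_lt_rpow hw.1.le hw.2 (by positivity)) 1
  · rintro ⟨hl, hr⟩
    have hpos : 0 < h := (Real.sqrt_nonneg _).trans_lt hl
    have hsq : 0 < 1 - h ^ 2 := by nlinarith
    have hlt : 1 - h ^ 2 < W ^ (1 / a) := by
      have := (Real.sqrt_lt' hpos).1 hl
      linarith
    refine ⟨(1 - h ^ 2) ^ a, ⟨Real.rpow_pos_of_pos hsq a, ?_⟩, ?_⟩
    · have := Real.rpow_lt_rpow hsq.le hlt ha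
      rwa [← Real.rpow_mul h0.le, one_div_mul_cancel ha.ne', Real.rpow_one] at this
    · rw [capHeight, ← Real.rpow_mul hsq.le, mul_one_div_cancel ha.ne', Real.rpow_one,
        sub_sub_cancel, Real.sqrt_sq hpos.le]

theorem hasDerivAt_capHeight {a w : ℝ} (ha : 0 < a) (h0 : 0 < w) (h1 : w < 1) :
    HasDerivAt (capHeight a) (-(w ^ (1 / a - 1) / (2 * a * capHeight a w))) w := by
  have hpos : 1 - w ^ (1 / a) ≠ 0 :=
    (sub_pos.2 (Real.rpow_lt_one h0.le h1 (by positivity))).ne'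
  convert! (((Real.hasDerivAt_rpow_const (p := 1 / a) (Or.inl h0.ne')).const_sub 1).sqrt hpos)
    using 1
  rw [capHeight]
  field_simp

theorem integral_capHeight {a W : ℝ} (ha : 0 < a) (h0 : 0 < W) (h1 : W ≤ 1) (g : ℝ → ℝ) :
    ∫ h in capHeight a W..1, (1 - h ^ 2) ^ (2 * a ^ 2 - 1) * g h =
      (2 * a)⁻¹ * ∫ w in Ioo 0 W, w ^ (2 * a - 1) * (g (capHeight a w) / capHeight a w) := by
  rw [integral_of_le (capHeight_lt_one h0).le, integral_Ioc_eq_integral_Ioo,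
    ← capHeight_image ha h0 h1, integral_image_eq_integral_abs_deriv_smul measurableSet_Ioo
      (fun w hw => (hasDerivAt_capHeight ha hw.1 (hw.2.trans_le h1)).hasDerivWithinAt),
    ← MeasureTheory.integral_const_mul]
  · refine setIntegral_congr_fun measurableSet_Ioo fun w hw => ?_
    have hw1 := hw.2.trans_le h1
    have hp := capHeight_pos ha hw.1.le hw1
    have hr := Real.rpow_pos_of_pos hw.1 (1 / a - 1)
    have hexp : w ^ (2 * a - 1) = w ^ (1 / a - 1) * (w ^ (1 / a)) ^ (2 * a ^ 2 - 1) := by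
      rw [← Real.rpow_mul hw.1.le, ← Real.rpow_add hw.1]
      congr 1
      field_simp
      ring
    simp only [smul_eq_mul]
    rw [abs_neg, abs_of_pos (by positivity), capHeight_sq ha hw.1.le hw1.le, hexp]
    field_simp
  · intro x hx y hy hxy
    rw [← one_sub_capHeight_sq_rpow ha hx.1.le (hx.2.le.trans h1), hxy,
      one_sub_capHeight_sq_rpow ha hy.1.le (hy.2.le.trans h1)]

/-- The constant in the cap asymptotics `1 - capCDF a h ∼ capScale a * (1 - h ^ 2) ^ a`. -/
noncomputable def capScale (a : ℝ) : ℝ := capConst a / (2 * a)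

theorem capScale_pos {a : ℝ} (ha : 0 < a) : 0 < capScale a :=
  div_pos (capConst_pos ha) (by positivity)

theorem scaled_integral_capHeight {a W N : ℝ} (ha : 0 < a) (h0 : 0 < W) (h1 : W ≤ 1) (hN : 0 < N)
    (g : ℝ → ℝ) :
    2 * a * N ^ (2 * a) *
        ∫ h in capHeight a W..1, (1 - h ^ 2) ^ (2 * a ^ 2 - 1) * g h =
      ∫ y, (Ioo 0 (W * N)).indicator
        (fun y => y ^ (2 * a - 1) * (g (capHeight a (y / N)) / capHeight a (y / N))) y := by
  rw [integral_capHeight ha h0 h1, ← MeasureTheory.integral_indicator measurableSet_Ioo]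
  have hscale := Measure.integral_comp_div ((Ioo 0 W).indicator
    fun w => w ^ (2 * a - 1) * (g (capHeight a w) / capHeight a w)) N
  rw [abs_of_pos hN, smul_eq_mul] at hscale
  have hpow : N ^ (2 * a) = N ^ (2 * a - 1) * N := by
    rw [← Real.rpow_add_one hN.ne', sub_add_cancel]
  rw [hpow, show ∀ x : ℝ, 2 * a * (N ^ (2 * a - 1) * N) * ((2 * a)⁻¹ * x) =
    N ^ (2 * a - 1) * (N * x) from fun x => by field_simp, ← hscale,
    ← MeasureTheory.integral_const_mul]
  congr 1
  ext y
  have hmem : y / N ∈ Ioo 0 W ↔ y ∈ Ioo 0 (W * N) := by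
    simp only [mem_Ioo, div_lt_iff₀ hN, div_pos_iff_of_pos_right hN]
  by_cases hy : y ∈ Ioo 0 (W * N)
  · rw [indicator_of_mem (hmem.2 hy), indicator_of_mem hy, Real.div_rpow hy.1.le hN.le]
    have := Real.rpow_pos_of_pos hN (2 * a - 1)
    field_simp
  · rw [indicator_of_notMem (hmem.not.2 hy), indicator_of_notMem hy, mul_zero]

theorem tendsto_capHeight_div {a : ℝ} (ha : 0 < a) (y : ℝ) :
    Tendsto (fun n : ℕ => capHeight a (y / (capScale a * n))) atTop (𝓝 1) := by
  rw [← capHeight_zero ha]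
  refine ((continuous_capHeight ha).tendsto 0).comp (Tendsto.const_div_atTop ?_ y)
  exact tendsto_natCast_atTop_atTop.const_mul_atTop (capScale_pos ha)

theorem eventually_div_capScale_lt {a : ℝ} (ha : 0 < a) (y : ℝ) {ε : ℝ} (hε : 0 < ε) :
    ∀ᶠ n : ℕ in atTop, y / (capScale a * n) < ε := by
  have h : Tendsto (fun n : ℕ => y / (capScale a * n)) atTop (𝓝 0) :=
    Tendsto.const_div_atTop (tendsto_natCast_atTop_atTop.const_mul_atTop (capScale_pos ha)) y
  exact h.eventually (gt_mem_nhds hε)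

theorem tendsto_capCDF_pow {a y : ℝ} (ha : 0 < a) (hy : 0 < y) (k : ℕ) :
    Tendsto (fun n : ℕ => capCDF a (capHeight a (y / (capScale a * n))) ^ (n - k)) atTop
      (𝓝 (Real.exp (-y))) := by
  set H : ℕ → ℝ := fun n => capHeight a (y / (capScale a * n)) with hH
  have hH1 : Tendsto H atTop (𝓝 1) := tendsto_capHeight_div ha y
  have hκ := capScale_pos ha
  have hbounds : ∀ᶠ n : ℕ in atTop,
      -(y / H n) ≤ n * (capCDF a (H n) - 1) ∧ n * (capCDF a (H n) - 1) ≤ -y := by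
    filter_upwards [eventually_div_capScale_lt ha y one_pos, eventually_gt_atTop 0] with n hn hn0
    have hn0' : (0 : ℝ) < n := Nat.cast_pos.2 hn0
    have hw : 0 < y / (capScale a * n) := by positivity
    have hp : 0 < H n := capHeight_pos ha hw.le hn
    have hl := le_capCDF ha hp (capHeight_lt_one hw)
    have hu := capCDF_le ha hp (capHeight_lt_one hw)
    rw [hH, one_sub_capHeight_sq_rpow ha hw.le hn.le] at hl hu
    change 1 - capScale a * (y / (capScale a * n)) / H n ≤ capCDF a (H n) at hl
    change capCDF a (H n) ≤ 1 - capScale a * (y / (capScale a * n)) at hu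
    have he : capScale a * (y / (capScale a * n)) = y / n := by field_simp
    rw [he] at hl hu
    constructor
    · calc -(y / H n) = n * (1 - y / n / H n - 1) := by field_simp; ring
        _ ≤ _ := by gcongr
    · calc (n : ℝ) * (capCDF a (H n) - 1) ≤ n * (1 - y / n - 1) := by gcongr
        _ = -y := by field_simp; ring
  have hlim : Tendsto (fun n : ℕ => n * (capCDF a (H n) - 1)) atTop (𝓝 (-y)) := by
    refine tendsto_of_tendsto_of_tendsto_of_le_of_le' ?_ tendsto_const_nhds
      (hbounds.mono fun _ h => h.1) (hbounds.mono fun _ h => h.2)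
    simpa [div_eq_mul_inv] using (hH1.inv₀ one_ne_zero |>.const_mul y).neg
  have hone : Tendsto (fun n => capCDF a (H n)) atTop (𝓝 1) := by
    simpa using (ProbabilityTheory.tendsto_zero_of_tendsto_mul_atTop hlim).add_const 1
  have hpow := (Real.tendsto_one_add_pow_exp_of_tendsto hlim).div (hone.pow k) (by simp)
  rw [one_pow, div_one] at hpow
  refine hpow.congr' ?_
  filter_upwards [eventually_ge_atTop k, hone.eventually_ne one_ne_zero] with n hn hne
  rw [Pi.div_apply, add_sub_cancel, pow_sub₀ _ hne hn, div_eq_mul_inv]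

theorem tendsto_scaled_integral_capCDF {a : ℝ} (ha : 0 < a) (k : ℕ) {W : ℕ → ℝ} {S : Set ℝ}
    (hS : MeasurableSet S) (hS0 : S ⊆ Ioi 0)
    (hW : ∀ᶠ n in atTop, 0 < W n ∧ W n ≤ (3 / 4) ^ a)
    (hlim : ∀ y, 0 < y → ∀ᶠ n : ℕ in atTop, (y < W n * (capScale a * n) ↔ y ∈ S)) :
    Tendsto (fun n : ℕ => 2 * a * (capScale a * n) ^ (2 * a) *
        ∫ h in capHeight a (W n)..1, (1 - h ^ 2) ^ (2 * a ^ 2 - 1) * capCDF a h ^ (n - k)) atTop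
      (𝓝 (∫ y in S, y ^ (2 * a - 1) * Real.exp (-y))) := by
  have hκ := capScale_pos ha
  have hquarter : (3 / 4 : ℝ) ^ a < 1 := Real.rpow_lt_one (by norm_num) (by norm_num) ha
  have hmain : Tendsto (fun n : ℕ => ∫ y, (Ioo 0 (W n * (capScale a * n))).indicator
        (fun y => y ^ (2 * a - 1) * (capCDF a (capHeight a (y / (capScale a * n))) ^ (n - k) /
          capHeight a (y / (capScale a * n)))) y) atTop
      (𝓝 (∫ y, S.indicator (fun y => y ^ (2 * a - 1) * Real.exp (-y)) y)) := by
    refine MeasureTheory.tendsto_integral_filter_of_dominated_convergence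
      ((Ioi 0).indicator fun y => 2 * (y ^ (2 * a - 1) * Real.exp (-(1 / 2) * y ^ (1 : ℝ))))
      ?_ ?_ ?_ ?_
    · filter_upwards [hW, eventually_gt_atTop 0] with n hWn hn0
      have hN : 0 < capScale a * n := mul_pos hκ (Nat.cast_pos.2 hn0)
      refine (aestronglyMeasurable_indicator_iff measurableSet_Ioo).2
        (ContinuousOn.aestronglyMeasurable ?_ measurableSet_Ioo)
      have hw : ∀ y ∈ Ioo 0 (W n * (capScale a * n)),
          0 < y / (capScale a * n) ∧ y / (capScale a * n) < 1 := fun y hy =>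
        ⟨div_pos hy.1 hN, ((div_lt_iff₀ hN).2 hy.2).trans_le (hWn.2.trans hquarter.le)⟩
      have hH : ContinuousOn (fun y => capHeight a (y / (capScale a * n)))
          (Ioo 0 (W n * (capScale a * n))) :=
        ((continuous_capHeight ha).comp (continuous_id.div_const _)).continuousOn
      refine ContinuousOn.mul (continuousOn_id.rpow_const fun y hy => Or.inl hy.1.ne')
        (ContinuousOn.div (((continuousOn_capCDF ha).comp hH fun y hy => ?_).pow _) hH
          fun y hy => (capHeight_pos ha (hw y hy).1.le (hw y hy).2).ne')
      have := capHeight_pos ha (hw y hy).1.le (hw y hy).2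
      exact ⟨by linarith, (capHeight_lt_one (hw y hy).1).le⟩
    · filter_upwards [hW, eventually_gt_atTop 0, eventually_ge_atTop (2 * k)] with n hWn hn0 hnk
      refine Eventually.of_forall fun y => ?_
      have hn : (0 : ℝ) < n := Nat.cast_pos.2 hn0
      have hN : 0 < capScale a * n := mul_pos hκ hn
      by_cases hy : y ∈ Ioo 0 (W n * (capScale a * n))
      · rw [indicator_of_mem hy, indicator_of_mem (show y ∈ Ioi 0 from hy.1), Real.rpow_one]
        have hw : 0 < y / (capScale a * n) := div_pos hy.1 hN
        have hwle : y / (capScale a * n) ≤ (3 / 4) ^ a :=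
          ((div_lt_iff₀ hN).2 hy.2).le.trans hWn.2
        have hw1 := hwle.trans_lt hquarter
        have hp := capHeight_pos ha hw.le hw1
        have hhalf := half_le_capHeight ha hw.le hwle
        have hlt : capHeight a (y / (capScale a * n)) < 1 := capHeight_lt_one hw
        have hF0 := capCDF_nonneg ha (h := capHeight a (y / (capScale a * n)))
          ⟨by linarith, hlt.le⟩
        have hF := capCDF_le ha hp hlt
        rw [one_sub_capHeight_sq_rpow ha hw.le hw1.le] at hF
        change _ ≤ 1 - capScale a * (y / (capScale a * n)) at hF
        rw [show capScale a * (y / (capScale a * n)) = y / n by field_simp] at hF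
        have hFexp := hF.trans (Real.one_sub_le_exp_neg _)
        have hFpow : capCDF a (capHeight a (y / (capScale a * n))) ^ (n - k) ≤
            Real.exp (-(1 / 2) * y) := by
          refine (pow_le_pow_left₀ hF0 hFexp _).trans ?_
          rw [← Real.exp_nat_mul, Real.exp_le_exp, Nat.cast_sub (by omega)]
          have hk : 2 * (k : ℝ) ≤ n := by exact_mod_cast hnk
          have : (n - k : ℝ) * -(y / n) - -(1 / 2) * y = -(y * (n - 2 * k) / (2 * n)) := by
            field_simp
            ring
          have : 0 ≤ y * (n - 2 * k) / (2 * n) :=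
            div_nonneg (mul_nonneg hy.1.le (by linarith)) (by positivity)
          linarith
        have hr := Real.rpow_nonneg hy.1.le (2 * a - 1)
        rw [Real.norm_of_nonneg (by positivity)]
        calc _ ≤ y ^ (2 * a - 1) * (Real.exp (-(1 / 2) * y) / (1 / 2)) := by gcongr
          _ = _ := by ring
      · rw [indicator_of_notMem hy, norm_zero]
        refine indicator_nonneg (fun y hy => ?_) y
        have := Real.rpow_nonneg (le_of_lt hy) (2 * a - 1)
        positivity
    · rw [integrable_indicator_iff measurableSet_Ioi]
      exact (integrableOn_rpow_mul_exp_neg_mul_rpow (by linarith) one_pos (by norm_num)).const_mul 2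
    · refine Eventually.of_forall fun y => ?_
      by_cases hy : 0 < y
      · by_cases hyS : y ∈ S
        · rw [indicator_of_mem hyS]
          have ht := ((tendsto_capCDF_pow ha hy k).div (tendsto_capHeight_div ha y)
            one_ne_zero).const_mul (y ^ (2 * a - 1))
          rw [div_one] at ht
          refine ht.congr' ?_
          filter_upwards [hlim y hy] with n hn
          rw [indicator_of_mem (show y ∈ Ioo _ _ from ⟨hy, hn.2 hyS⟩), Pi.div_apply]
        · rw [indicator_of_notMem hyS]
          refine tendsto_const_nhds.congr' ?_
          filter_upwards [hlim y hy] with n hn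
          rw [indicator_of_notMem fun h => hyS (hn.1 h.2)]
      · rw [indicator_of_notMem fun h => hy (hS0 h)]
        refine tendsto_const_nhds.congr fun n => ?_
        rw [indicator_of_notMem fun h => hy h.1]
  rw [← MeasureTheory.integral_indicator hS]
  refine hmain.congr' ?_
  filter_upwards [hW, eventually_gt_atTop 0] with n hWn hn0
  exact (scaled_integral_capHeight ha hWn.1 (hWn.2.trans hquarter.le)
    (mul_pos hκ (Nat.cast_pos.2 hn0)) fun h => capCDF a h ^ (n - k)).symm

theorem intervalIntegrable_height {a : ℝ} (ha : 0 < a) (m : ℕ) {x y : ℝ}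
    (hx : x ∈ Icc (-1 : ℝ) 1) (hy : y ∈ Icc (-1 : ℝ) 1) :
    IntervalIntegrable (fun h : ℝ => (1 - h ^ 2) ^ (2 * a ^ 2 - 1) * capCDF a h ^ m)
      volume x y :=
  (intervalIntegrable_one_sub_sq_rpow_of_mem (by positivity) hx hy).mul_continuousOn
    (((continuousOn_capCDF ha).pow m).mono (uIcc_subset_Icc hx hy))

theorem height_integrand_nonneg {a h : ℝ} (ha : 0 < a) (m : ℕ) (hh : h ∈ Icc (-1 : ℝ) 1) :
    0 ≤ (1 - h ^ 2) ^ (2 * a ^ 2 - 1) * capCDF a h ^ m :=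
  mul_nonneg (one_sub_sq_rpow_nonneg hh.1 hh.2) (pow_nonneg (capCDF_nonneg ha hh) m)

theorem tendsto_pow_mul_pow_sub {q : ℝ} (h0 : 0 < q) (h1 : q < 1) (p k : ℕ) :
    Tendsto (fun n : ℕ => (n : ℝ) ^ p * q ^ (n - k)) atTop (𝓝 0) := by
  have h := (tendsto_pow_const_mul_const_pow_of_lt_one p h0.le h1).mul_const (q ^ k)⁻¹
  rw [zero_mul] at h
  refine h.congr' ?_
  filter_upwards [eventually_ge_atTop k] with n hn
  rw [pow_sub₀ _ h0.ne' hn, mul_assoc]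

theorem tendsto_scaled_integral_away {a : ℝ} (ha : 0 < a) {p : ℕ} (hp : 2 * a = p) (k : ℕ)
    {x : ℕ → ℝ} (hx : ∀ᶠ n in atTop, x n ∈ Icc (-1 : ℝ) (1 / 2)) :
    Tendsto (fun n : ℕ => 2 * a * (capScale a * n) ^ (2 * a) *
        ∫ h in (-1)..(x n), (1 - h ^ 2) ^ (2 * a ^ 2 - 1) * capCDF a h ^ (n - k)) atTop
      (𝓝 0) := by
  have hκ := capScale_pos ha
  have hneg : (-1 : ℝ) ∈ Icc (-1 : ℝ) 1 := by norm_num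
  have hhalf : (1 / 2 : ℝ) ∈ Icc (-1 : ℝ) 1 := by constructor <;> norm_num
  obtain ⟨q, hq0, hq1, hq⟩ : ∃ q : ℝ, 0 < q ∧ q < 1 ∧ capCDF a (1 / 2) ≤ q := by
    refine ⟨max (1 / 2) (capCDF a (1 / 2)), by positivity, max_lt (by norm_num) ?_, le_max_right ..⟩
    have h := capCDF_le ha (h := 1 / 2) (by norm_num) (by norm_num)
    have : 0 < capConst a / (2 * a) * (1 - (1 / 2 : ℝ) ^ 2) ^ a :=
      mul_pos hκ (Real.rpow_pos_of_pos (by norm_num) a)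
    linarith
  set J : ℝ := ∫ h in (-1 : ℝ)..(1 / 2), (1 - h ^ 2) ^ (2 * a ^ 2 - 1)
  have hub : Tendsto (fun n : ℕ => 2 * a * capScale a ^ p * J * ((n : ℝ) ^ p * q ^ (n - k)))
      atTop (𝓝 0) := by
    simpa using (tendsto_pow_mul_pow_sub hq0 hq1 p k).const_mul (2 * a * capScale a ^ p * J)
  refine squeeze_zero' ?_ ?_ hub
  · filter_upwards [hx] with n hn
    refine mul_nonneg (by positivity) (intervalIntegral.integral_nonneg hn.1 fun h hh => ?_)
    exact height_integrand_nonneg ha _ ⟨hh.1, by linarith [hh.2, hn.2]⟩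
  · filter_upwards [hx] with n hn
    have hxn : x n ∈ Icc (-1 : ℝ) 1 := ⟨hn.1, by linarith [hn.2]⟩
    have hI : ∫ h in (-1)..(x n), (1 - h ^ 2) ^ (2 * a ^ 2 - 1) * capCDF a h ^ (n - k) ≤
        J * q ^ (n - k) := by
      calc _ ≤ ∫ h in (-1 : ℝ)..(1 / 2), (1 - h ^ 2) ^ (2 * a ^ 2 - 1) * capCDF a h ^ (n - k) := by
            rw [← integral_add_adjacent_intervals (intervalIntegrable_height ha _ hneg hxn)
              (intervalIntegrable_height ha _ hxn hhalf), le_add_iff_nonneg_right]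
            exact intervalIntegral.integral_nonneg hn.2 fun h hh =>
              height_integrand_nonneg ha _ ⟨hn.1.trans hh.1, hh.2.trans hhalf.2⟩
        _ ≤ ∫ h in (-1 : ℝ)..(1 / 2), (1 - h ^ 2) ^ (2 * a ^ 2 - 1) * q ^ (n - k) := by
            refine integral_mono_on hhalf.1 (intervalIntegrable_height ha _ hneg hhalf)
              ((intervalIntegrable_one_sub_sq_rpow_of_mem (by positivity) hneg hhalf).mul_const _)
              fun h hh => ?_
            have hh' : h ∈ Icc (-1 : ℝ) 1 := ⟨hh.1, hh.2.trans hhalf.2⟩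
            have := one_sub_sq_rpow_nonneg (p := 2 * a ^ 2 - 1) hh'.1 hh'.2
            have := capCDF_nonneg ha hh'
            have := (capCDF_mono ha hh.1 hh.2 hhalf.2).trans hq
            gcongr
        _ = _ := intervalIntegral.integral_mul_const _ _
    calc _ ≤ 2 * a * (capScale a * n) ^ (2 * a) * (J * q ^ (n - k)) := by gcongr
      _ = _ := by
        rw [hp, Real.rpow_natCast, mul_pow]
        ring

theorem tendsto_height_ratio {a t : ℝ} (ha : 0 < a) {p : ℕ} (hp : 2 * a = p) (k : ℕ)
    (ht : 0 < t) :
    Tendsto (fun n : ℕ =>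
        ((∫ h in (-1)..(-capHeight a (t / (capScale a * n))),
            (1 - h ^ 2) ^ (2 * a ^ 2 - 1) * capCDF a h ^ (n - k)) +
          ∫ h in capHeight a (t / (capScale a * n))..1,
            (1 - h ^ 2) ^ (2 * a ^ 2 - 1) * capCDF a h ^ (n - k)) /
        ∫ h in (-1)..1, (1 - h ^ 2) ^ (2 * a ^ 2 - 1) * capCDF a h ^ (n - k)) atTop
      (𝓝 ((Real.Gamma (2 * a))⁻¹ * ∫ s in (0 : ℝ)..t, s ^ (2 * a - 1) * Real.exp (-s))) := by
  have hκ := capScale_pos ha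
  have hδ : (0 : ℝ) < (3 / 4) ^ a := by positivity
  have hT : ∀ᶠ n : ℕ in atTop, 0 < t / (capScale a * n) ∧ t / (capScale a * n) ≤ (3 / 4) ^ a := by
    filter_upwards [eventually_div_capScale_lt ha t hδ, eventually_gt_atTop 0] with n hn hn0
    have hn0' : (0 : ℝ) < n := Nat.cast_pos.2 hn0
    exact ⟨by positivity, hn.le⟩
  have hA := tendsto_scaled_integral_capCDF ha k (S := Ioo 0 t) measurableSet_Ioo
    (fun y hy => hy.1) hT fun y hy => by
      filter_upwards [eventually_gt_atTop 0] with n hn0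
      have hn0' : (0 : ℝ) < n := Nat.cast_pos.2 hn0
      rw [div_mul_cancel₀ _ (by positivity), mem_Ioo, and_iff_right hy]
  have hB := tendsto_scaled_integral_capCDF ha k (W := fun _ => (3 / 4) ^ a) (S := Ioi 0)
    measurableSet_Ioi subset_rfl (Eventually.of_forall fun _ => ⟨hδ, le_rfl⟩) fun y hy => by
      filter_upwards [eventually_div_capScale_lt ha y hδ, eventually_gt_atTop 0] with n hn hn0
      have hn0' : (0 : ℝ) < n := Nat.cast_pos.2 hn0
      rw [mem_Ioi, iff_true_right hy, ← div_lt_iff₀ (by positivity)]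
      exact hn
  have hE := tendsto_scaled_integral_away ha hp k (x := fun _ => 1 / 2)
    (Eventually.of_forall fun _ => ⟨by norm_num, le_rfl⟩)
  have hE' := tendsto_scaled_integral_away ha hp k
    (x := fun n => -capHeight a (t / (capScale a * n))) <| by
      filter_upwards [hT] with n hn
      have h1 := half_le_capHeight ha hn.1.le hn.2
      have h2 : capHeight a (t / (capScale a * n)) < 1 := capHeight_lt_one hn.1
      exact ⟨by linarith, by linarith⟩
  have hΓ : ∫ y in Ioi 0, y ^ (2 * a - 1) * Real.exp (-y) = Real.Gamma (2 * a) := by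
    rw [Real.Gamma_eq_integral (by positivity)]
    simp only [mul_comm]
  have hΓ0 : Real.Gamma (2 * a) ≠ 0 := (Real.Gamma_pos_of_pos (by positivity)).ne'
  rw [hΓ] at hB
  have hlim := (hE'.add hA).div (hE.add hB) (by rwa [zero_add])
  rw [zero_add, zero_add, ← integral_Ioc_eq_integral_Ioo, ← integral_of_le ht.le] at hlim
  rw [← div_eq_inv_mul]
  refine hlim.congr' ?_
  filter_upwards [eventually_gt_atTop 0] with n hn0
  have hn0' : (0 : ℝ) < n := Nat.cast_pos.2 hn0
  have hhalf : (1 / 2 : ℝ) ∈ Icc (-1 : ℝ) 1 := by constructor <;> norm_num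
  simp only [Pi.div_apply]
  rw [capHeight_three_quarters_rpow ha, ← mul_add, ← mul_add,
    integral_add_adjacent_intervals
      (intervalIntegrable_height ha _ (left_mem_Icc.2 (by norm_num)) hhalf)
      (intervalIntegrable_height ha _ hhalf (right_mem_Icc.2 (by norm_num))),
    mul_div_mul_left _ _ (by positivity)]

theorem II_eq_integral_capCDF (n d : ℕ) (x y : ℝ) :
    II n d x y = ∫ h in x..y, (1 - h ^ 2) ^ (2 * (((d : ℝ) - 1) / 2) ^ 2 - 1) *
      capCDF (((d : ℝ) - 1) / 2) h ^ (n - d) := by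
  rw [II]
  simp only [capCDF, capConst, c1]
  rw [show ((d : ℝ) ^ 2 - 2 * d - 1) / 2 = 2 * (((d : ℝ) - 1) / 2) ^ 2 - 1 by ring,
    show ((d : ℝ) - 3) / 2 = ((d : ℝ) - 1) / 2 - 1 by ring,
    show ((d : ℝ) - 1) / 2 + 1 / 2 = d / 2 by ring]

/-- fixed dimension `d ≥ 2`. The renormalized quantity
`Y_n = n·(Γ(d/2)/(2√π Γ((d+1)/2)))·(1-H_typ²)^{(d-1)/2}` converges in distribution
to a Gamma(d-1) random variable. -/
theorem typical_height_gamma_fixed_dim (d : ℕ) (hd : 2 ≤ d) :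
    ∀ t : ℝ, 0 < t →
      Tendsto (fun n : ℕ =>
          (II n d (-1)
              (-(Real.sqrt (1 -
                (2 * Real.sqrt Real.pi * Real.Gamma (((d : ℝ) + 1) / 2) * t /
                  ((n : ℝ) * Real.Gamma ((d : ℝ) / 2))) ^ (2 / ((d : ℝ) - 1))))) +
            II n d
              (Real.sqrt (1 -
                (2 * Real.sqrt Real.pi * Real.Gamma (((d : ℝ) + 1) / 2) * t /
                  ((n : ℝ) * Real.Gamma ((d : ℝ) / 2))) ^ (2 / ((d : ℝ) - 1)))) 1) /
          II n d (-1) 1) atTop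
        (nhds ((Real.Gamma ((d : ℝ) - 1))⁻¹ *
          ∫ s in (0 : ℝ)..t, s ^ ((d : ℝ) - 2) * Real.exp (-s))) := by
  intro t ht
  have hd' : (2 : ℝ) ≤ d := by exact_mod_cast hd
  set a : ℝ := ((d : ℝ) - 1) / 2 with ha_def
  have ha : 0 < a := by rw [ha_def]; linarith
  have h2a : 2 * a = (d : ℝ) - 1 := by rw [ha_def]; ring
  have hp : 2 * a = ((d - 1 : ℕ) : ℝ) := by
    rw [h2a, Nat.cast_sub (by omega), Nat.cast_one]
  have hmain := tendsto_height_ratio ha hp d ht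
  rw [h2a, show (d : ℝ) - 1 - 1 = d - 2 by ring] at hmain
  refine hmain.congr fun n => ?_
  have harg : 2 * √Real.pi * Real.Gamma (((d : ℝ) + 1) / 2) * t / (n * Real.Gamma ((d : ℝ) / 2)) =
      t / (capScale a * n) := by
    have g1 := (Real.Gamma_pos_of_pos ha).ne'
    have g2 := (Real.Gamma_pos_of_pos (show (0 : ℝ) < d / 2 by positivity)).ne'
    rw [capScale, capConst, show ((d : ℝ) + 1) / 2 = a + 1 by rw [ha_def]; ring,
      Real.Gamma_add_one ha.ne', show a + 1 / 2 = (d : ℝ) / 2 by rw [ha_def]; ring]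
    field_simp
  have hexp : 2 / ((d : ℝ) - 1) = 1 / a := by rw [ha_def, one_div_div]
  simp only [II_eq_integral_capCDF, harg, hexp]
  rfl
end

section
/- Assume d(n) → ∞ and (n − d)/d → 0. Then there exist a constant K > 0 and a sequence ε_n → 0 such that for all n large enough, |ln(2^{n−d−1}·F(n,d,−1,1)/C(n,d)) − (n−d)²/(π d)| ≤ K·(n−d)³/d² + ε_n. In other words, F(n,d,−1,1) = C(n,d)·2^{d−n+1}·exp((n−d)²/(πd) + O((n−d)³/d²) + o(1)). -/
open Filter

namespace FacetCount

open MeasureTheory Set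

/-! ### Gamma function estimates -/

lemma Gamma_mul_pow_le {s : ℝ} (hs : 0 < s) (k : ℕ) :
    Real.Gamma s * s ^ k ≤ Real.Gamma (s + k) := by
  induction k with
  | zero => simp
  | succ k ih =>
    have hk : 0 < s + k := by positivity
    have h : s + ((k + 1 : ℕ) : ℝ) = (s + k) + 1 := by push_cast; ring
    rw [h, Real.Gamma_add_one hk.ne', pow_succ, ← mul_assoc, mul_comm (s + k)]
    have hG := Real.Gamma_pos_of_pos hs
    gcongr
    linarith [Nat.cast_nonneg (α := ℝ) k]

lemma Gamma_add_nat_le {s : ℝ} (hs : 0 < s) (k : ℕ) {t : ℝ} (ht : s + k ≤ t) :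
    Real.Gamma (s + k) ≤ Real.Gamma s * t ^ k := by
  induction k with
  | zero => simp
  | succ k ih =>
    push_cast at ht
    have hk : 0 < s + k := by positivity
    have h : s + ((k + 1 : ℕ) : ℝ) = (s + k) + 1 := by push_cast; ring
    have hG := Real.Gamma_pos_of_pos hs
    have ht0 : 0 < t := by linarith
    rw [h, Real.Gamma_add_one hk.ne', pow_succ, ← mul_assoc, mul_comm (s + k)]
    have := ih (by linarith)
    gcongr
    linarith

lemma Gamma_ratio_le {a b : ℝ} (ha : 0 < a) (hab : a ≤ b) (k : ℕ) :
    Real.Gamma a * Real.Gamma (b + k) * a ^ k ≤ Real.Gamma (a + k) * Real.Gamma b * b ^ k := by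
  induction k with
  | zero => simp
  | succ k ih =>
    have hb : 0 < b := ha.trans_le hab
    have hak : 0 < a + k := by positivity
    have hbk : 0 < b + k := by positivity
    have h1 : a + ((k + 1 : ℕ) : ℝ) = (a + k) + 1 := by push_cast; ring
    have h2 : b + ((k + 1 : ℕ) : ℝ) = (b + k) + 1 := by push_cast; ring
    rw [h1, h2, Real.Gamma_add_one hak.ne', Real.Gamma_add_one hbk.ne']
    have hG1 := Real.Gamma_pos_of_pos hak
    have hG2 := Real.Gamma_pos_of_pos hb
    have key : (b + k) * a ≤ (a + k) * b := by
      nlinarith [mul_le_mul_of_nonneg_left hab (Nat.cast_nonneg (α := ℝ) k)]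
    calc Real.Gamma a * ((b + k) * Real.Gamma (b + k)) * a ^ (k + 1)
        = (Real.Gamma a * Real.Gamma (b + k) * a ^ k) * ((b + k) * a) := by ring
      _ ≤ (Real.Gamma (a + k) * Real.Gamma b * b ^ k) * ((a + k) * b) := by gcongr
      _ = _ := by ring

lemma Gamma_nat_add_half (k : ℕ) :
    Real.Gamma (k + 1 / 2) =
      Real.sqrt Real.pi * ((2 * k).factorial / (4 ^ k * k.factorial)) := by
  induction k with
  | zero => simpa using Real.Gamma_one_half_eq
  | succ k ih =>
    have h : ((k + 1 : ℕ) : ℝ) + 1 / 2 = (k + 1 / 2) + 1 := by push_cast; ring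
    rw [h, Real.Gamma_add_one (by positivity), ih, show 2 * (k + 1) = 2 * k + 1 + 1 by ring,
      Nat.factorial_succ, Nat.factorial_succ, Nat.factorial_succ]
    have : (k.factorial : ℝ) ≠ 0 := by positivity
    push_cast
    field_simp
    ring

lemma Gamma_add_half_sq_le {x : ℝ} (hx : 0 < x) :
    Real.Gamma (x + 1 / 2) ^ 2 ≤ x * Real.Gamma x ^ 2 := by
  have h := Real.Gamma_mul_add_mul_le_rpow_Gamma_mul_rpow_Gamma hx (by linarith : 0 < x + 1)
    (by norm_num : (0 : ℝ) < 1 / 2) (by norm_num : (0 : ℝ) < 1 / 2) (by norm_num)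
  have h1 : (1 / 2 : ℝ) * x + 1 / 2 * (x + 1) = x + 1 / 2 := by ring
  have hG := Real.Gamma_pos_of_pos hx
  have hG1 := Real.Gamma_pos_of_pos (by linarith : 0 < x + 1)
  rw [h1, ← Real.mul_rpow hG.le hG1.le, ← Real.sqrt_eq_rpow] at h
  have h2 := Real.Gamma_pos_of_pos (by linarith : 0 < x + 1 / 2)
  calc Real.Gamma (x + 1 / 2) ^ 2 ≤ Real.sqrt (Real.Gamma x * Real.Gamma (x + 1)) ^ 2 := by gcongr
    _ = x * Real.Gamma x ^ 2 := by
      rw [Real.sq_sqrt (by positivity), Real.Gamma_add_one hx.ne']; ring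

lemma c1_pos {d : ℕ} (hd : 3 ≤ d) : 0 < c1 d := by
  have hd' : (3 : ℝ) ≤ d := by exact_mod_cast hd
  have h1 := Real.Gamma_pos_of_pos (by linarith : (0 : ℝ) < (d : ℝ) / 2)
  have h2 := Real.Gamma_pos_of_pos (by linarith : (0 : ℝ) < ((d : ℝ) - 1) / 2)
  unfold c1
  positivity

lemma c1_sq_le {d : ℕ} (hd : 3 ≤ d) : c1 d ^ 2 ≤ ((d : ℝ) - 1) / (2 * Real.pi) := by
  have hd' : (3 : ℝ) ≤ d := by exact_mod_cast hd
  have h2 := Real.Gamma_pos_of_pos (by linarith : (0 : ℝ) < ((d : ℝ) - 1) / 2)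
  have h := Gamma_add_half_sq_le (by linarith : (0 : ℝ) < ((d : ℝ) - 1) / 2)
  rw [show ((d : ℝ) - 1) / 2 + 1 / 2 = d / 2 by ring] at h
  unfold c1
  rw [div_pow, mul_pow, Real.sq_sqrt Real.pi_pos.le, div_le_div_iff₀ (by positivity)
    (by positivity)]
  nlinarith [mul_le_mul_of_nonneg_left h (by positivity : 0 ≤ 2 * Real.pi)]

lemma le_c1_sq {d : ℕ} (hd : 3 ≤ d) : ((d : ℝ) - 2) / (2 * Real.pi) ≤ c1 d ^ 2 := by
  have hd' : (3 : ℝ) ≤ d := by exact_mod_cast hd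
  have h2 := Real.Gamma_pos_of_pos (by linarith : (0 : ℝ) < ((d : ℝ) - 1) / 2)
  have hx : (0 : ℝ) < ((d : ℝ) - 2) / 2 := by linarith
  have h := Gamma_add_half_sq_le hx
  rw [show ((d : ℝ) - 2) / 2 + 1 / 2 = ((d : ℝ) - 1) / 2 by ring] at h
  have h3 := Real.Gamma_add_one hx.ne'
  rw [show ((d : ℝ) - 2) / 2 + 1 = d / 2 by ring] at h3
  unfold c1
  rw [div_pow, mul_pow, Real.sq_sqrt Real.pi_pos.le, div_le_div_iff₀ (by positivity)
    (by positivity), h3]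
  nlinarith [mul_le_mul_of_nonneg_left h (mul_nonneg Real.pi_pos.le (by linarith) :
    0 ≤ Real.pi * ((d : ℝ) - 2))]

/-! ### Beta integrals -/

lemma integral_rpow_mul_one_sub_rpow {a b : ℝ} (ha : 0 < a) (hb : 0 < b) :
    ∫ u in (0 : ℝ)..1, u ^ (a - 1) * (1 - u) ^ (b - 1) =
      Real.Gamma a * Real.Gamma b / Real.Gamma (a + b) := by
  have h := ProbabilityTheory.beta_eq_betaIntegralReal a b ha hb
  unfold ProbabilityTheory.beta at h
  rw [h, Complex.betaIntegral]
  have : ∀ x ∈ uIcc (0 : ℝ) 1, (x : ℂ) ^ ((a : ℂ) - 1) * (1 - (x : ℂ)) ^ ((b : ℂ) - 1) =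
      ((x ^ (a - 1) * (1 - x) ^ (b - 1) : ℝ) : ℂ) := by
    intro x hx
    rw [uIcc_of_le zero_le_one] at hx
    have h1 : 0 ≤ 1 - x := by linarith [hx.2]
    push_cast [Complex.ofReal_cpow hx.1, Complex.ofReal_cpow h1]
    rfl
  rw [intervalIntegral.integral_congr this, intervalIntegral.integral_ofReal, Complex.ofReal_re]

lemma continuous_one_sub_sq_rpow {b : ℝ} (hb : 0 ≤ b) :
    Continuous fun h : ℝ => (1 - h ^ 2) ^ b :=
  (by fun_prop : Continuous fun h : ℝ => 1 - h ^ 2).rpow_const fun _ => Or.inr hb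

lemma integral_pow_mul_one_sub_sq_rpow (k : ℕ) {b : ℝ} (hb : 0 ≤ b) :
    ∫ h in (-1 : ℝ)..1, h ^ (2 * k) * (1 - h ^ 2) ^ b =
      Real.Gamma (k + 1 / 2) * Real.Gamma (b + 1) / Real.Gamma (b + 3 / 2 + k) := by
  have hc : Continuous fun h : ℝ => h ^ (2 * k) * (1 - h ^ 2) ^ b :=
    (continuous_pow _).mul (continuous_one_sub_sq_rpow hb)
  have hsub : (∫ x in (0 : ℝ)..1,
        ((fun u : ℝ => u ^ ((k + 1 / 2 : ℝ) - 1) * (1 - u) ^ ((b + 1) - 1)) ∘ fun x => x ^ 2) x *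
          (2 * x)) =
      ∫ u in (0 : ℝ) ^ 2..1 ^ 2, u ^ ((k + 1 / 2 : ℝ) - 1) * (1 - u) ^ ((b + 1) - 1) := by
    apply intervalIntegral.integral_comp_mul_deriv_of_deriv_nonneg (f := fun x : ℝ => x ^ 2)
    · fun_prop
    · intro x _
      simpa using hasDerivAt_pow 2 x
    · intro x hx
      rw [min_eq_left zero_le_one] at hx
      linarith [hx.1]
  have hcongr : ∀ x ∈ Ioc (0 : ℝ) 1,
      ((fun u : ℝ => u ^ ((k + 1 / 2 : ℝ) - 1) * (1 - u) ^ ((b + 1) - 1)) ∘ fun x => x ^ 2) x *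
          (2 * x) = 2 * (x ^ (2 * k) * (1 - x ^ 2) ^ b) := by
    intro x ⟨hx0, hx1⟩
    have : (x ^ 2) ^ ((k + 1 / 2 : ℝ) - 1) * x = x ^ (2 * k) := by
      rw [← Real.rpow_natCast, ← Real.rpow_natCast, ← Real.rpow_mul hx0.le]
      nth_rewrite 2 [← Real.rpow_one x]
      rw [← Real.rpow_add hx0]
      congr 1
      push_cast
      ring
    simp only [Function.comp_apply, add_sub_cancel_right]
    rw [← this]
    ring
  have heven : (∫ h in (-1 : ℝ)..0, h ^ (2 * k) * (1 - h ^ 2) ^ b) =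
      ∫ h in (0 : ℝ)..1, h ^ (2 * k) * (1 - h ^ 2) ^ b := by
    have := intervalIntegral.integral_comp_neg (a := 0) (b := 1)
      (fun h : ℝ => h ^ (2 * k) * (1 - h ^ 2) ^ b)
    simpa [Even.neg_pow (even_two_mul k)] using this.symm
  rw [← intervalIntegral.integral_add_adjacent_intervals (hc.intervalIntegrable (-1) 0)
    (hc.intervalIntegrable 0 1), heven, ← two_mul, ← intervalIntegral.integral_const_mul,
    ← intervalIntegral.integral_congr_ae (ae_of_all _ fun x hx => hcongr x
      (by rwa [uIoc_of_le zero_le_one] at hx)), hsub]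
  norm_num only [zero_pow, one_pow]
  rw [integral_rpow_mul_one_sub_rpow (by positivity) (by positivity)]
  congr 2
  ring

/-! ### The centred cap function -/

/-- The unnormalised one-dimensional marginal mass between heights `0` and `h`. -/
noncomputable def cap (d : ℕ) (h : ℝ) : ℝ :=
  ∫ s in (0 : ℝ)..h, (1 - s ^ 2) ^ (((d : ℝ) - 3) / 2)

lemma continuous_density {d : ℕ} (hd : 3 ≤ d) :
    Continuous fun s : ℝ => (1 - s ^ 2) ^ (((d : ℝ) - 3) / 2) := by
  have hd' : (3 : ℝ) ≤ d := by exact_mod_cast hd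
  exact continuous_one_sub_sq_rpow (by linarith)

lemma continuous_cap {d : ℕ} (hd : 3 ≤ d) : Continuous (cap d) :=
  intervalIntegral.continuous_primitive
    (fun _ _ => (continuous_density hd).intervalIntegrable _ _) 0

lemma cap_neg (d : ℕ) (h : ℝ) : cap d (-h) = -cap d h := by
  have := intervalIntegral.integral_comp_neg (a := 0) (b := h)
    (fun s : ℝ => (1 - s ^ 2) ^ (((d : ℝ) - 3) / 2))
  simp only [neg_sq, neg_zero] at this
  unfold cap
  rw [this, intervalIntegral.integral_symm]

lemma c1_mul_integral {d : ℕ} (hd : 3 ≤ d) (h : ℝ) :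
    c1 d * ∫ s in (-1 : ℝ)..h, (1 - s ^ 2) ^ (((d : ℝ) - 3) / 2) = 1 / 2 + c1 d * cap d h := by
  have hd' : (3 : ℝ) ≤ d := by exact_mod_cast hd
  have hc := continuous_density hd
  have hsplit : ∀ x, ∫ s in (-1 : ℝ)..x, (1 - s ^ 2) ^ (((d : ℝ) - 3) / 2) =
      cap d 1 + cap d x := by
    intro x
    rw [← intervalIntegral.integral_add_adjacent_intervals (hc.intervalIntegrable (-1) 0)
      (hc.intervalIntegrable 0 x), intervalIntegral.integral_symm, ← cap, cap_neg, neg_neg, ← cap]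
  have htot := integral_pow_mul_one_sub_sq_rpow 0 (by linarith : 0 ≤ ((d : ℝ) - 3) / 2)
  simp only [mul_zero, pow_zero, one_mul, Nat.cast_zero, zero_add, add_zero,
    Real.Gamma_one_half_eq] at htot
  rw [hsplit, show ((d : ℝ) - 3) / 2 + 1 = (d - 1) / 2 by ring,
    show ((d : ℝ) - 3) / 2 + 3 / 2 = d / 2 by ring] at htot
  have h1 := Real.Gamma_pos_of_pos (by linarith : (0 : ℝ) < (d : ℝ) / 2)
  have h2 := Real.Gamma_pos_of_pos (by linarith : (0 : ℝ) < ((d : ℝ) - 1) / 2)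
  have hpi := Real.sqrt_pos.2 Real.pi_pos
  have hone : c1 d * (cap d 1 + cap d 1) = 1 := by
    rw [htot, c1]
    field_simp
  rw [hsplit]
  linarith

lemma cap_bounds_of_nonneg {d : ℕ} (hd : 3 ≤ d) {h : ℝ} (h0 : 0 ≤ h) (h1 : h ≤ 1) :
    h * (1 - h ^ 2) ^ (((d : ℝ) - 3) / 2) ≤ cap d h ∧ cap d h ≤ h := by
  have hd' : (3 : ℝ) ≤ d := by exact_mod_cast hd
  have hc := continuous_density hd
  constructor
  · have := intervalIntegral.integral_mono_on h0 (intervalIntegrable_const (μ := volume)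
      (c := (1 - h ^ 2) ^ (((d : ℝ) - 3) / 2))) (hc.intervalIntegrable 0 h) (fun s hs => by
        apply Real.rpow_le_rpow
        · nlinarith
        · nlinarith [hs.1, hs.2]
        · linarith)
    simpa [cap] using this
  · have := intervalIntegral.integral_mono_on h0 (hc.intervalIntegrable 0 h)
      (intervalIntegrable_const (μ := volume) (c := (1 : ℝ))) (fun s hs => by
        apply Real.rpow_le_one
        · nlinarith [hs.1, hs.2]
        · nlinarith [hs.1, hs.2]
        · linarith)
    simpa [cap] using this

lemma cap_sq_bounds {d : ℕ} (hd : 3 ≤ d) {h : ℝ} (hh : h ∈ Icc (-1 : ℝ) 1) :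
    h ^ 2 * (1 - h ^ 2) ^ (d - 3) ≤ cap d h ^ 2 ∧ cap d h ^ 2 ≤ h ^ 2 := by
  have key : ∀ x : ℝ, 0 ≤ x → x ≤ 1 →
      x ^ 2 * (1 - x ^ 2) ^ (d - 3) ≤ cap d x ^ 2 ∧ cap d x ^ 2 ≤ x ^ 2 := by
    intro x h0 h1
    obtain ⟨hl, hu⟩ := cap_bounds_of_nonneg hd h0 h1
    have hx : 0 ≤ 1 - x ^ 2 := by nlinarith
    have hp : 0 ≤ x * (1 - x ^ 2) ^ (((d : ℝ) - 3) / 2) :=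
      mul_nonneg h0 (Real.rpow_nonneg hx _)
    refine ⟨?_, pow_le_pow_left₀ (hp.trans hl) hu 2⟩
    calc x ^ 2 * (1 - x ^ 2) ^ (d - 3)
        = (x * (1 - x ^ 2) ^ (((d : ℝ) - 3) / 2)) ^ 2 := by
          rw [mul_pow, ← Real.rpow_mul_natCast hx, ← Real.rpow_natCast (1 - x ^ 2) (d - 3),
            Nat.cast_sub hd]
          congr 2
          push_cast
          ring
      _ ≤ _ := pow_le_pow_left₀ hp hl 2
  rcases le_total 0 h with h0 | h0
  · exact key h h0 hh.2
  · have := key (-h) (by linarith) (by linarith [hh.1])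
    simpa [cap_neg] using this

/-! ### Moments of the centred cap function -/

/-- The density exponent of the height of a random facet hyperplane. -/
noncomputable def expo (d : ℕ) : ℝ := ((d : ℝ) ^ 2 - 2 * (d : ℝ) - 1) / 2

/-- Moments of twice the centred cap probability at a random height. -/
noncomputable def moment (d j : ℕ) : ℝ :=
  c2 d * ∫ h in (-1 : ℝ)..1, (1 - h ^ 2) ^ expo d * (2 * c1 d * cap d h) ^ j

lemma expo_nonneg {d : ℕ} (hd : 3 ≤ d) : 0 ≤ expo d := by
  have hd' : (3 : ℝ) ≤ d := by exact_mod_cast hd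
  unfold expo
  nlinarith

lemma c2_eq (d : ℕ) :
    c2 d = Real.Gamma (expo d + 3 / 2) / (Real.sqrt Real.pi * Real.Gamma (expo d + 1)) := by
  unfold c2 expo
  congr 2
  · ring
  · congr 2
    ring

lemma c2_pos {d : ℕ} (hd : 3 ≤ d) : 0 < c2 d := by
  have h := expo_nonneg hd
  have h1 := Real.Gamma_pos_of_pos (by linarith : 0 < expo d + 3 / 2)
  have h2 := Real.Gamma_pos_of_pos (by linarith : 0 < expo d + 1)
  rw [c2_eq]
  positivity

lemma moment_integrable {d : ℕ} (hd : 3 ≤ d) (j : ℕ) :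
    IntervalIntegrable (fun h : ℝ => (1 - h ^ 2) ^ expo d * (2 * c1 d * cap d h) ^ j)
      volume (-1) 1 := by
  have h1 := continuous_one_sub_sq_rpow (expo_nonneg hd)
  have h2 := continuous_cap hd
  exact (h1.mul ((continuous_const.mul h2).pow j)).intervalIntegrable _ _

lemma moment_odd (d k : ℕ) : moment d (2 * k + 1) = 0 := by
  have := intervalIntegral.integral_comp_neg (a := -1) (b := 1)
    (fun h : ℝ => (1 - h ^ 2) ^ expo d * (2 * c1 d * cap d h) ^ (2 * k + 1))
  simp only [neg_sq, cap_neg, mul_neg, Odd.neg_pow (odd_two_mul_add_one k), neg_neg,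
    intervalIntegral.integral_neg] at this
  unfold moment
  rw [show (∫ h in (-1 : ℝ)..1, (1 - h ^ 2) ^ expo d * (2 * c1 d * cap d h) ^ (2 * k + 1)) = 0 by
    linarith, mul_zero]

lemma moment_even_le {d : ℕ} (hd : 3 ≤ d) (k : ℕ) :
    moment d (2 * k) ≤ c1 d ^ (2 * k) * ((2 * k).factorial / k.factorial) /
      (expo d + 3 / 2) ^ k := by
  have he := expo_nonneg hd
  have hS : 0 < expo d + 3 / 2 := by linarith
  have hG1 := Real.Gamma_pos_of_pos hS
  have hG2 := Real.Gamma_pos_of_pos (by linarith : 0 < expo d + 1)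
  have hG3 := Real.Gamma_pos_of_pos (by positivity : 0 < expo d + 3 / 2 + k)
  have hpi := Real.sqrt_pos.2 Real.pi_pos
  have hc2 := c2_pos hd
  have hmono : (∫ h in (-1 : ℝ)..1, (1 - h ^ 2) ^ expo d * (2 * c1 d * cap d h) ^ (2 * k)) ≤
      ∫ h in (-1 : ℝ)..1, (2 * c1 d) ^ (2 * k) * (h ^ (2 * k) * (1 - h ^ 2) ^ expo d) := by
    apply intervalIntegral.integral_mono_on (by norm_num) (moment_integrable hd _)
    · exact (continuous_const.mul ((continuous_pow _).mul
        (continuous_one_sub_sq_rpow he))).intervalIntegrable _ _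
    · intro h hh
      have hw : 0 ≤ (1 - h ^ 2) ^ expo d := Real.rpow_nonneg (by nlinarith [hh.1, hh.2]) _
      have hb := (cap_sq_bounds hd hh).2
      rw [mul_pow, pow_mul (cap d h), pow_mul h]
      calc _ = (2 * c1 d) ^ (2 * k) * ((cap d h ^ 2) ^ k * (1 - h ^ 2) ^ expo d) := by ring
        _ ≤ _ := by
          have : 0 ≤ (2 * c1 d) ^ (2 * k) := (even_two_mul k).pow_nonneg _
          gcongr
  rw [intervalIntegral.integral_const_mul, integral_pow_mul_one_sub_sq_rpow k he,
    Gamma_nat_add_half] at hmono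
  calc moment d (2 * k) ≤ c2 d * _ := mul_le_mul_of_nonneg_left hmono hc2.le
    _ = c1 d ^ (2 * k) * ((2 * k).factorial / k.factorial) *
        (Real.Gamma (expo d + 3 / 2) / Real.Gamma (expo d + 3 / 2 + k)) := by
      rw [c2_eq, mul_pow, pow_mul 2 2 k]
      norm_num only
      field_simp
    _ ≤ c1 d ^ (2 * k) * ((2 * k).factorial / k.factorial) * (1 / (expo d + 3 / 2) ^ k) := by
      have : 0 ≤ c1 d ^ (2 * k) := (even_two_mul k).pow_nonneg _
      refine mul_le_mul_of_nonneg_left ?_ (by positivity)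
      rw [div_le_div_iff₀ hG3 (by positivity), one_mul]
      exact Gamma_mul_pow_le hS k
    _ = _ := by rw [mul_one_div]

lemma le_moment_even {d : ℕ} (hd : 3 ≤ d) (k : ℕ) :
    c1 d ^ (2 * k) * ((2 * k).factorial / k.factorial) / (expo d + 3 / 2) ^ k *
      (((expo d + 1) / (expo d + 3 / 2)) ^ (k * (d - 3)) *
        ((expo d + 3 / 2) / (expo d + 3 / 2 + (k * (d - 3) : ℕ) + k)) ^ k) ≤ moment d (2 * k) := by
  have he := expo_nonneg hd
  have hS : 0 < expo d + 3 / 2 := by linarith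
  have hS1 : 0 < expo d + 1 := by linarith
  set T : ℕ := k * (d - 3) with hT
  have hG1 := Real.Gamma_pos_of_pos hS
  have hG2 := Real.Gamma_pos_of_pos hS1
  have hG3 := Real.Gamma_pos_of_pos (by positivity : 0 < expo d + 3 / 2 + T + k)
  have hG4 := Real.Gamma_pos_of_pos (by positivity : 0 < expo d + 3 / 2 + T)
  have hpi := Real.sqrt_pos.2 Real.pi_pos
  have hc2 := c2_pos hd
  have hmono : (∫ h in (-1 : ℝ)..1,
        (2 * c1 d) ^ (2 * k) * (h ^ (2 * k) * (1 - h ^ 2) ^ (expo d + T))) ≤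
      ∫ h in (-1 : ℝ)..1, (1 - h ^ 2) ^ expo d * (2 * c1 d * cap d h) ^ (2 * k) := by
    apply intervalIntegral.integral_mono_on (by norm_num) _ (moment_integrable hd _)
    · intro h hh
      have hx : 0 ≤ 1 - h ^ 2 := by nlinarith [hh.1, hh.2]
      have hw : 0 ≤ (1 - h ^ 2) ^ expo d := Real.rpow_nonneg hx _
      have hb := (cap_sq_bounds hd hh).1
      rw [Real.rpow_add_of_nonneg hx he (Nat.cast_nonneg _), Real.rpow_natCast, hT, mul_comm k,
        pow_mul (1 - h ^ 2), mul_pow (2 * c1 d), pow_mul (cap d h), pow_mul h]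
      calc _ = (2 * c1 d) ^ (2 * k) *
            ((h ^ 2 * (1 - h ^ 2) ^ (d - 3)) ^ k * (1 - h ^ 2) ^ expo d) := by ring
        _ ≤ (2 * c1 d) ^ (2 * k) * ((cap d h ^ 2) ^ k * (1 - h ^ 2) ^ expo d) := by
          have : 0 ≤ (2 * c1 d) ^ (2 * k) := (even_two_mul k).pow_nonneg _
          gcongr
        _ = _ := by ring
    · exact (continuous_const.mul ((continuous_pow _).mul
        (continuous_one_sub_sq_rpow (by positivity)))).intervalIntegrable _ _
  rw [intervalIntegral.integral_const_mul,
    integral_pow_mul_one_sub_sq_rpow k (by positivity : 0 ≤ expo d + T),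
    Gamma_nat_add_half, show expo d + T + 1 = expo d + 1 + T by ring,
    show expo d + T + 3 / 2 + k = expo d + 3 / 2 + T + k by ring] at hmono
  refine le_trans ?_ (mul_le_mul_of_nonneg_left hmono hc2.le)
  have hr1 := Gamma_ratio_le hS1 (by linarith : expo d + 1 ≤ expo d + 3 / 2) T
  have hr2 := Gamma_add_nat_le (by positivity : 0 < expo d + 3 / 2 + T) k le_rfl
  have hr : ((expo d + 1) / (expo d + 3 / 2)) ^ T *
      (1 / (expo d + 3 / 2 + T + k) ^ k) ≤
      Real.Gamma (expo d + 1 + T) * Real.Gamma (expo d + 3 / 2) /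
        (Real.Gamma (expo d + 1) * Real.Gamma (expo d + 3 / 2 + T + k)) := by
    rw [div_pow, div_mul_div_comm, mul_one, div_le_div_iff₀ (by positivity) (by positivity)]
    calc (expo d + 1) ^ T * (Real.Gamma (expo d + 1) * Real.Gamma (expo d + 3 / 2 + T + k))
        ≤ (expo d + 1) ^ T * (Real.Gamma (expo d + 1) *
            (Real.Gamma (expo d + 3 / 2 + T) * (expo d + 3 / 2 + T + k) ^ k)) := by gcongr
      _ = (Real.Gamma (expo d + 1) * Real.Gamma (expo d + 3 / 2 + T) * (expo d + 1) ^ T) *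
            (expo d + 3 / 2 + T + k) ^ k := by ring
      _ ≤ (Real.Gamma (expo d + 1 + T) * Real.Gamma (expo d + 3 / 2) * (expo d + 3 / 2) ^ T) *
            (expo d + 3 / 2 + T + k) ^ k := by gcongr
      _ = _ := by ring
  calc _ = c1 d ^ (2 * k) * ((2 * k).factorial / k.factorial) *
        (((expo d + 1) / (expo d + 3 / 2)) ^ T * (1 / (expo d + 3 / 2 + T + k) ^ k)) := by
        rw [div_pow _ _ k]
        field_simp
    _ ≤ c1 d ^ (2 * k) * ((2 * k).factorial / k.factorial) * _ := by
      have : 0 ≤ c1 d ^ (2 * k) := (even_two_mul k).pow_nonneg _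
      exact mul_le_mul_of_nonneg_left hr (by positivity)
    _ = _ := by
      rw [c2_eq, mul_pow, pow_mul 2 2 k]
      norm_num only
      field_simp

/-! ### Expansion of the facet count -/

lemma sum_range_two_mul (f : ℕ → ℝ) (N : ℕ) :
    ∑ j ∈ Finset.range (2 * N), f j = ∑ k ∈ Finset.range N, (f (2 * k) + f (2 * k + 1)) := by
  induction N with
  | zero => simp
  | succ N ih =>
    rw [show 2 * (N + 1) = 2 * N + 1 + 1 by ring, Finset.sum_range_succ, Finset.sum_range_succ,
      ih, Finset.sum_range_succ]
    ring

lemma normalized_FF_eq {n d : ℕ} (hd : 3 ≤ d) (hn : d < n) :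
    (2 : ℝ) ^ ((n : ℝ) - (d : ℝ) - 1) * FF n d (-1) 1 / (n.choose d : ℝ) =
      ∑ k ∈ Finset.range (n - d + 1), ((n - d).choose (2 * k) : ℝ) * moment d (2 * k) := by
  obtain ⟨m, rfl⟩ := Nat.exists_eq_add_of_lt hn
  have hsub : d + m + 1 - d = m + 1 := by omega
  have hchoose : ((d + m + 1).choose d : ℝ) ≠ 0 := by
    exact_mod_cast (Nat.choose_pos (by omega)).ne'
  have hpow : (2 : ℝ) ^ (((d + m + 1 : ℕ) : ℝ) - (d : ℝ) - 1) = 2 ^ m := by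
    rw [← Real.rpow_natCast]
    congr 1
    push_cast
    ring
  have hint : ∀ h : ℝ, 2 ^ (m + 1) * ((1 - h ^ 2) ^ (((d : ℝ) ^ 2 - 2 * (d : ℝ) - 1) / 2) *
      (c1 d * ∫ s in (-1 : ℝ)..h, (1 - s ^ 2) ^ (((d : ℝ) - 3) / 2)) ^ (m + 1)) =
      ∑ j ∈ Finset.range (m + 1 + 1), ((m + 1).choose j : ℝ) *
        ((1 - h ^ 2) ^ expo d * (2 * c1 d * cap d h) ^ j) := by
    intro h
    rw [c1_mul_integral hd, ← expo, mul_left_comm, ← mul_pow,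
      show 2 * (1 / 2 + c1 d * cap d h) = 2 * c1 d * cap d h + 1 by ring, add_pow,
      Finset.mul_sum]
    refine Finset.sum_congr rfl fun j _ => ?_
    rw [one_pow]
    ring
  calc (2 : ℝ) ^ (((d + m + 1 : ℕ) : ℝ) - (d : ℝ) - 1) * FF (d + m + 1) d (-1) 1 /
        ((d + m + 1).choose d : ℝ)
      = c2 d * (2 ^ (m + 1) * II (d + m + 1) d (-1) 1) := by
        rw [hpow, FF]
        field_simp
        ring
    _ = ∑ j ∈ Finset.range (m + 1 + 1), ((m + 1).choose j : ℝ) * moment d j := by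
        rw [II, hsub, ← intervalIntegral.integral_const_mul]
        simp_rw [hint]
        rw [intervalIntegral.integral_finsetSum
          (fun j _ => (moment_integrable hd j).const_mul _), Finset.mul_sum]
        refine Finset.sum_congr rfl fun j _ => ?_
        rw [intervalIntegral.integral_const_mul, moment]
        ring
    _ = ∑ j ∈ Finset.range (2 * (m + 1 + 1)), ((m + 1).choose j : ℝ) * moment d j := by
        refine Finset.sum_subset (Finset.range_mono (by omega)) fun j _ hj => ?_
        rw [Finset.mem_range, not_lt] at hj
        rw [Nat.choose_eq_zero_of_lt (by omega), Nat.cast_zero, zero_mul]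
    _ = _ := by
        rw [sum_range_two_mul, hsub]
        simp [moment_odd]

/-! ### Term-by-term comparison with an exponential series -/

/-- The parameter of the exponential series that approximates the normalised facet count. -/
noncomputable def rate (d m : ℕ) : ℝ := (m : ℝ) ^ 2 * c1 d ^ 2 / (expo d + 3 / 2)

lemma rate_nonneg {d : ℕ} (hd : 3 ≤ d) (m : ℕ) : 0 ≤ rate d m := by
  have := expo_nonneg hd
  unfold rate
  positivity

lemma choose_mul_moment_le {d : ℕ} (hd : 3 ≤ d) (m k : ℕ) :
    (m.choose (2 * k) : ℝ) * moment d (2 * k) ≤ rate d m ^ k / k.factorial := by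
  have he := expo_nonneg hd
  have hc := c1_pos hd
  calc (m.choose (2 * k) : ℝ) * moment d (2 * k)
      ≤ (m.choose (2 * k) : ℝ) * (c1 d ^ (2 * k) * ((2 * k).factorial / k.factorial) /
        (expo d + 3 / 2) ^ k) :=
        mul_le_mul_of_nonneg_left (moment_even_le hd k) (Nat.cast_nonneg _)
    _ ≤ ((m : ℝ) ^ (2 * k) / (2 * k).factorial) *
        (c1 d ^ (2 * k) * ((2 * k).factorial / k.factorial) / (expo d + 3 / 2) ^ k) :=
        mul_le_mul_of_nonneg_right (Nat.choose_le_pow_div _ _) (by positivity)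
    _ = _ := by
        rw [rate, div_pow, mul_pow, ← pow_mul, ← pow_mul]
        field_simp

lemma exp_neg_two_mul_le {x : ℝ} (h0 : 0 ≤ x) (h1 : x ≤ 1 / 2) :
    Real.exp (-(2 * x)) ≤ 1 - x := by
  have hx : 0 < 1 - x := by linarith
  rw [← Real.le_log_iff_exp_le hx]
  refine le_trans ?_ (Real.one_sub_inv_le_log_of_pos hx)
  have : (1 - x)⁻¹ ≤ 1 + 2 * x := by
    rw [inv_le_iff_one_le_mul₀ hx]
    nlinarith
  linarith

lemma exp_neg_div_le {S y : ℝ} (hS : 0 < S) (hy : 0 ≤ y) :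
    Real.exp (-(y / S)) ≤ S / (S + y) := by
  rw [Real.exp_neg, inv_le_comm₀ (Real.exp_pos _) (by positivity), inv_div]
  have := Real.add_one_le_exp (y / S)
  calc (S + y) / S = y / S + 1 := by field_simp; ring
    _ ≤ _ := this

lemma le_choose_two_mul {m k : ℕ} (hm : 0 < m) (hk : 4 * k ≤ m) :
    (m : ℝ) ^ (2 * k) / (2 * k).factorial * Real.exp (-(8 * (k : ℝ) ^ 2 / m)) ≤
      m.choose (2 * k) := by
  have hm' : (0 : ℝ) < m := by exact_mod_cast hm
  have hk' : 4 * (k : ℝ) ≤ m := by exact_mod_cast hk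
  have h1 : (((m - 2 * k : ℕ) : ℝ)) ^ (2 * k) ≤ (m.choose (2 * k) : ℝ) * (2 * k).factorial := by
    have h := Nat.pow_sub_le_descFactorial m (2 * k)
    rw [Nat.descFactorial_eq_factorial_mul_choose, mul_comm (Nat.factorial _)] at h
    have h' : (m - 2 * k) ^ (2 * k) ≤ (m + 1 - 2 * k) ^ (2 * k) :=
      Nat.pow_le_pow_left (by omega) _
    exact_mod_cast h'.trans h
  have h2 := exp_neg_two_mul_le (x := 2 * k / m) (by positivity)
    (by rw [div_le_div_iff₀ hm' two_pos]; linarith)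
  have h3 : (m : ℝ) * (1 - 2 * k / m) = ((m - 2 * k : ℕ) : ℝ) := by
    rw [Nat.cast_sub (by omega)]
    push_cast
    field_simp
  rw [div_mul_eq_mul_div, div_le_iff₀ (by positivity)]
  refine le_trans ?_ h1
  rw [← h3, mul_pow]
  refine mul_le_mul_of_nonneg_left ?_ (by positivity)
  calc Real.exp (-(8 * (k : ℝ) ^ 2 / m)) = Real.exp (-(2 * (2 * k / m))) ^ (2 * k) := by
        rw [← Real.exp_nat_mul]
        congr 1
        push_cast
        ring
    _ ≤ _ := pow_le_pow_left₀ (Real.exp_pos _).le h2 _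

lemma le_choose_mul_moment {d m k : ℕ} (hd : 4 ≤ d) (hm : 0 < m) (hmd : m ≤ d)
    (hk : 4 * k ≤ m) :
    rate d m ^ k / k.factorial * Real.exp (-(32 * (k : ℝ) ^ 2 / m)) ≤
      (m.choose (2 * k) : ℝ) * moment d (2 * k) := by
  have hd3 : 3 ≤ d := by omega
  have he := expo_nonneg hd3
  have hc := c1_pos hd3
  have hd' : (4 : ℝ) ≤ d := by exact_mod_cast hd
  have hm' : (0 : ℝ) < m := by exact_mod_cast hm
  have hmd' : (m : ℝ) ≤ d := by exact_mod_cast hmd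
  have hkk : (k : ℝ) ≤ (k : ℝ) ^ 2 := by exact_mod_cast Nat.le_self_pow two_ne_zero k
  set S : ℝ := expo d + 3 / 2 with hSdef
  have hSd : (d : ℝ) ^ 2 / 4 ≤ S := by
    rw [hSdef, expo]
    nlinarith
  have hS : 0 < S := by linarith
  have hS1 : 1 ≤ S := by linarith
  set T : ℕ := k * (d - 3) with hTdef
  have hT : (T : ℝ) + k ≤ k * d := by
    rw [hTdef, Nat.cast_mul, Nat.cast_sub hd3]
    push_cast
    nlinarith [Nat.cast_nonneg (α := ℝ) k]
  have hdm : ∀ x : ℝ, 0 ≤ x → x * d / S ≤ 4 * x / m := by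
    intro x hx
    rw [div_le_div_iff₀ hS hm']
    have : (d : ℝ) * m ≤ 4 * S := by nlinarith
    nlinarith [mul_le_mul_of_nonneg_left this hx]
  have hF2 : Real.exp (-(4 * (k : ℝ) ^ 2 / m)) ≤ ((expo d + 1) / S) ^ T := by
    have h1 := exp_neg_two_mul_le (x := 1 / (2 * S)) (by positivity)
      (by rw [div_le_div_iff₀ (by positivity) two_pos]; linarith)
    have h2 : 1 - 1 / (2 * S) = (expo d + 1) / S := by
      rw [eq_div_iff hS.ne', sub_mul, hSdef]
      field_simp
      ring
    rw [h2] at h1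
    refine le_trans ?_ (pow_le_pow_left₀ (Real.exp_pos _).le h1 T)
    rw [← Real.exp_nat_mul, Real.exp_le_exp]
    have h3 : (T : ℝ) / S ≤ k * d / S := by
      gcongr
      linarith [Nat.cast_nonneg (α := ℝ) k]
    have h4 := hdm k (Nat.cast_nonneg _)
    have h5 : 4 * (k : ℝ) / m ≤ 4 * (k : ℝ) ^ 2 / m := by gcongr
    have h6 : (T : ℝ) * -(2 * (1 / (2 * S))) = -(T / S) := by field_simp
    rw [h6]
    linarith
  have hF3 : Real.exp (-(4 * (k : ℝ) ^ 2 / m)) ≤ (S / (S + T + k)) ^ k := by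
    have h1 := exp_neg_div_le hS (by positivity : 0 ≤ (T : ℝ) + k)
    rw [← add_assoc] at h1
    refine le_trans ?_ (pow_le_pow_left₀ (Real.exp_pos _).le h1 k)
    rw [← Real.exp_nat_mul, Real.exp_le_exp, mul_neg, neg_le_neg_iff]
    calc (k : ℝ) * ((T + k) / S) ≤ k * (k * d / S) := by gcongr
      _ = (k : ℝ) ^ 2 * d / S := by ring
      _ ≤ _ := hdm _ (by positivity)
  have hF1 := le_choose_two_mul hm hk
  have hmom := le_moment_even hd3 k
  calc rate d m ^ k / k.factorial * Real.exp (-(32 * (k : ℝ) ^ 2 / m))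
      ≤ rate d m ^ k / k.factorial * Real.exp (-(8 * (k : ℝ) ^ 2 / m) +
        (-(4 * (k : ℝ) ^ 2 / m) + -(4 * (k : ℝ) ^ 2 / m))) := by
        have := rate_nonneg hd3 m
        gcongr
        have : 0 ≤ (k : ℝ) ^ 2 / m := by positivity
        simp only [mul_div_assoc]
        linarith
    _ = ((m : ℝ) ^ (2 * k) / (2 * k).factorial * Real.exp (-(8 * (k : ℝ) ^ 2 / m))) *
        (c1 d ^ (2 * k) * ((2 * k).factorial / k.factorial) / S ^ k *
          (Real.exp (-(4 * (k : ℝ) ^ 2 / m)) * Real.exp (-(4 * (k : ℝ) ^ 2 / m)))) := by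
        rw [Real.exp_add, Real.exp_add, rate, ← hSdef, div_pow, mul_pow, ← pow_mul, ← pow_mul]
        field_simp
    _ ≤ (m.choose (2 * k) : ℝ) * (c1 d ^ (2 * k) * ((2 * k).factorial / k.factorial) / S ^ k *
          (((expo d + 1) / S) ^ T * (S / (S + T + k)) ^ k)) := by gcongr
    _ ≤ _ := mul_le_mul_of_nonneg_left hmom (Nat.cast_nonneg _)

lemma hasSum_pow_div_factorial (x : ℝ) :
    HasSum (fun k : ℕ => x ^ k / k.factorial) (Real.exp x) := by
  rw [Real.exp_eq_exp_ℝ]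
  exact NormedSpace.expSeries_div_hasSum_exp x

lemma hasSum_mul_pow_div_factorial (x : ℝ) :
    HasSum (fun k : ℕ => (k : ℝ) * (x ^ k / k.factorial)) (x * Real.exp x) := by
  rw [← hasSum_nat_add_iff' 1]
  simp only [Finset.sum_range_one, Nat.cast_zero, zero_mul, sub_zero]
  refine ((hasSum_pow_div_factorial x).mul_left x).congr_fun fun k => ?_
  rw [Nat.factorial_succ]
  push_cast
  field_simp
  ring

lemma hasSum_sq_mul_pow_div_factorial (x : ℝ) :
    HasSum (fun k : ℕ => (k : ℝ) ^ 2 * (x ^ k / k.factorial)) ((x ^ 2 + x) * Real.exp x) := by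
  rw [← hasSum_nat_add_iff' 1]
  have h := ((hasSum_mul_pow_div_factorial x).add (hasSum_pow_div_factorial x)).mul_left x
  rw [show x * (x * Real.exp x + Real.exp x) = (x ^ 2 + x) * Real.exp x by ring] at h
  simp only [Finset.sum_range_one, Nat.cast_zero, ne_eq, OfNat.ofNat_ne_zero, not_false_eq_true,
    zero_pow, zero_mul, sub_zero]
  refine h.congr_fun fun k => ?_
  rw [Nat.factorial_succ]
  push_cast
  field_simp
  ring

/-- A truncated, Gaussian-damped exponential series is bounded below by replacing the damping
factor with its tangent line at the value attained by the mean of `k ^ 2`. -/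
lemma exp_sub_le_sum {a : ℕ → ℝ} {l x : ℝ} {m : ℕ} (hl : 0 ≤ l) (hm : 0 < m)
    (hx : x = 32 * (l ^ 2 + l) / m) (hxm : x + 1 ≤ 2 * m) (ha : ∀ k, 0 ≤ a k)
    (hak : ∀ k, 4 * k ≤ m →
      l ^ k / k.factorial * Real.exp (-(32 * (k : ℝ) ^ 2 / m)) ≤ a k) :
    Real.exp (l - x) ≤ ∑ k ∈ Finset.range (m + 1), a k := by
  have hm' : (0 : ℝ) < m := by exact_mod_cast hm
  set b : ℕ → ℝ := fun k =>
    Real.exp (-x) * (1 + x - 32 * (k : ℝ) ^ 2 / m) * (l ^ k / k.factorial) with hb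
  have hsum : HasSum b (Real.exp (l - x)) := by
    have h := ((hasSum_pow_div_factorial l).mul_left (Real.exp (-x) * (1 + x))).sub
      ((hasSum_sq_mul_pow_div_factorial l).mul_left (Real.exp (-x) * (32 / m)))
    convert! h using 1
    · ext k
      rw [hb]
      ring
    · rw [sub_eq_add_neg, Real.exp_add]
      have : 32 / (m : ℝ) * (l ^ 2 + l) = x := by rw [hx]; ring
      calc Real.exp l * Real.exp (-x)
          = Real.exp (-x) * (1 + x) * Real.exp l - Real.exp (-x) * x * Real.exp l := by ring
        _ = _ := by rw [← this]; ring
  have hneg : ∀ k, m < 4 * k → b k ≤ 0 := by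
    intro k hk
    have hk' : (m : ℝ) ≤ 4 * k := by exact_mod_cast hk.le
    have h1 : 1 + x ≤ 32 * (k : ℝ) ^ 2 / m := by
      rw [le_div_iff₀ hm']
      nlinarith
    exact mul_nonpos_of_nonpos_of_nonneg
      (mul_nonpos_of_nonneg_of_nonpos (Real.exp_pos _).le (by linarith)) (by positivity)
  have hle : ∀ k, b k ≤ a k := by
    intro k
    rcases le_or_gt (4 * k) m with hk | hk
    · refine le_trans ?_ (hak k hk)
      rw [mul_comm (l ^ k / _)]
      refine mul_le_mul_of_nonneg_right ?_ (by positivity)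
      have h := Real.add_one_le_exp (x - 32 * (k : ℝ) ^ 2 / m)
      calc Real.exp (-x) * (1 + x - 32 * (k : ℝ) ^ 2 / m)
          ≤ Real.exp (-x) * Real.exp (x - 32 * (k : ℝ) ^ 2 / m) := by
            refine mul_le_mul_of_nonneg_left ?_ (Real.exp_pos _).le
            linarith
        _ = _ := by rw [← Real.exp_add]; congr 1; ring
    · exact (hneg k hk).trans (ha k)
  have h := sum_le_hasSum (Finset.range (m + 1)) (fun k hk => by
    rw [Finset.mem_range, not_lt] at hk
    exact neg_nonneg.2 (hneg k (by omega))) hsum.neg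
  rw [Finset.sum_neg_distrib, neg_le_neg_iff] at h
  exact h.trans (Finset.sum_le_sum fun k _ => hle k)

lemma moment_even_nonneg {d : ℕ} (hd : 3 ≤ d) (k : ℕ) : 0 ≤ moment d (2 * k) := by
  have he := expo_nonneg hd
  have := c1_pos hd
  exact le_trans (by positivity) (le_moment_even hd k)

lemma abs_log_normalized_FF_sub_le {n d : ℕ} (hd : 4 ≤ d) (hn : d < n)
    (hr : ((n : ℝ) - d) / d ≤ 1 / 64) :
    |Real.log ((2 : ℝ) ^ ((n : ℝ) - (d : ℝ) - 1) * FF n d (-1) 1 / (n.choose d : ℝ)) -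
        ((n : ℝ) - (d : ℝ)) ^ 2 / (Real.pi * (d : ℝ))| ≤
      32 * ((n : ℝ) - (d : ℝ)) ^ 3 / (d : ℝ) ^ 2 +
        ((((n : ℝ) - d) / d) ^ 2 + 32 * (((n : ℝ) - d) / d)) := by
  have hd3 : 3 ≤ d := by omega
  rw [normalized_FF_eq hd3 hn]
  obtain ⟨m, hm⟩ : ∃ m, m = n - d := ⟨_, rfl⟩
  have hnd : (n : ℝ) - d = m := by rw [hm, Nat.cast_sub hn.le]
  have hm0 : 0 < m := by omega
  have hm1 : (1 : ℝ) ≤ m := by exact_mod_cast hm0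
  have hd' : (4 : ℝ) ≤ d := by exact_mod_cast hd
  have hdpos : (0 : ℝ) < d := by linarith
  rw [hnd] at hr ⊢
  rw [← hm]
  set r : ℝ := (m : ℝ) / d with hrdef
  have hr0 : 0 ≤ r := by positivity
  have hmr : (m : ℝ) = r * d := by rw [hrdef]; field_simp
  have hmd : m ≤ d := by
    have : (m : ℝ) ≤ d := by rw [hmr]; nlinarith
    exact_mod_cast this
  set l := rate d m with hl
  have hl0 : 0 ≤ l := rate_nonneg hd3 m
  have hpi := Real.pi_gt_three
  have hpi0 := Real.pi_pos
  have hS : expo d + 3 / 2 = ((d : ℝ) ^ 2 - 2 * d + 2) / 2 := by rw [expo]; ring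
  have hSpos : 0 < (d : ℝ) ^ 2 - 2 * d + 2 := by nlinarith
  have hlu : l ≤ (m : ℝ) ^ 2 / Real.pi * ((d - 1) / ((d : ℝ) ^ 2 - 2 * d + 2)) := by
    rw [hl, rate, hS]
    calc (m : ℝ) ^ 2 * c1 d ^ 2 / (((d : ℝ) ^ 2 - 2 * d + 2) / 2)
        ≤ (m : ℝ) ^ 2 * ((d - 1) / (2 * Real.pi)) / (((d : ℝ) ^ 2 - 2 * d + 2) / 2) := by
          have := c1_sq_le hd3
          gcongr
      _ = _ := by field_simp
  have hll : (m : ℝ) ^ 2 / Real.pi * ((d - 2) / ((d : ℝ) ^ 2 - 2 * d + 2)) ≤ l := by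
    rw [hl, rate, hS]
    calc _ = (m : ℝ) ^ 2 * ((d - 2) / (2 * Real.pi)) / (((d : ℝ) ^ 2 - 2 * d + 2) / 2) := by
          field_simp
      _ ≤ _ := by
          have := le_c1_sq hd3
          gcongr
  have hdiv : (m : ℝ) ^ 2 / Real.pi ≤ (m : ℝ) ^ 2 := div_le_self (by positivity) (by linarith)
  have hmain : (m : ℝ) ^ 2 / (Real.pi * d) = (m : ℝ) ^ 2 / Real.pi * (1 / d) := by field_simp
  have hr2 : r ^ 2 = (m : ℝ) ^ 2 * (1 / (d : ℝ) ^ 2) := by rw [hrdef]; field_simp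
  have hupper : l - (m : ℝ) ^ 2 / (Real.pi * d) ≤ r ^ 2 := by
    have h : ((d : ℝ) - 1) / ((d : ℝ) ^ 2 - 2 * d + 2) ≤ 1 / d + 1 / (d : ℝ) ^ 2 := by
      rw [show 1 / (d : ℝ) + 1 / (d : ℝ) ^ 2 = (d + 1) / (d : ℝ) ^ 2 by field_simp,
        div_le_div_iff₀ hSpos (by positivity)]
      nlinarith
    have h1 := mul_le_mul_of_nonneg_left h (by positivity : 0 ≤ (m : ℝ) ^ 2 / Real.pi)
    have h2 := mul_le_mul_of_nonneg_right hdiv (by positivity : 0 ≤ 1 / (d : ℝ) ^ 2)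
    rw [hmain, hr2]
    linarith
  have hlower : (m : ℝ) ^ 2 / (Real.pi * d) - l ≤ r ^ 2 := by
    have h : 1 / (d : ℝ) ≤ (d - 2) / ((d : ℝ) ^ 2 - 2 * d + 2) + 1 / (d : ℝ) ^ 2 := by
      rw [div_add_div _ _ hSpos.ne' (by positivity), div_le_div_iff₀ hdpos (by positivity)]
      nlinarith
    have h1 := mul_le_mul_of_nonneg_left h (by positivity : 0 ≤ (m : ℝ) ^ 2 / Real.pi)
    have h2 := mul_le_mul_of_nonneg_right hdiv (by positivity : 0 ≤ 1 / (d : ℝ) ^ 2)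
    rw [hmain, hr2]
    linarith
  have hlmr : l ≤ m * r := by
    have h1 : (m : ℝ) ^ 2 / (Real.pi * d) = m * r / Real.pi := by rw [hrdef]; field_simp
    have h2 : m * r / Real.pi ≤ m * r / 3 := by gcongr
    have h3 : r ^ 2 ≤ m * r / 64 := by nlinarith
    have h4 : 0 ≤ m * r := by positivity
    linarith
  set x : ℝ := 32 * (l ^ 2 + l) / m with hx
  have hxle : x ≤ 32 * (m * r ^ 2 + r) := by
    rw [hx, div_le_iff₀ (by linarith)]
    have h : l * l ≤ m * r * (m * r) := mul_le_mul hlmr hlmr hl0 (by positivity)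
    calc 32 * (l ^ 2 + l) = 32 * (l * l) + 32 * l := by ring
      _ ≤ 32 * (m * r * (m * r)) + 32 * (m * r) := by linarith
      _ = _ := by ring
  have hxm : x + 1 ≤ 2 * m := by
    have h : r ^ 2 ≤ 1 / 64 := by nlinarith
    have := mul_le_mul_of_nonneg_left h (by linarith : (0 : ℝ) ≤ m)
    linarith
  have hcube : 32 * (m : ℝ) ^ 3 / (d : ℝ) ^ 2 = 32 * (m * r ^ 2) := by
    rw [hrdef]
    field_simp
  set X := ∑ k ∈ Finset.range (m + 1), (m.choose (2 * k) : ℝ) * moment d (2 * k) with hX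
  have hXl : Real.exp (l - x) ≤ X :=
    exp_sub_le_sum hl0 hm0 hx hxm
      (fun k => mul_nonneg (Nat.cast_nonneg _) (moment_even_nonneg hd3 k))
      (fun k hk => le_choose_mul_moment hd hm0 hmd hk)
  have hXu : X ≤ Real.exp l :=
    (Finset.sum_le_sum fun k _ => choose_mul_moment_le hd3 m k).trans
      (Real.sum_le_exp_of_nonneg hl0 _)
  have hXpos : 0 < X := (Real.exp_pos _).trans_le hXl
  have h1 : l - x ≤ Real.log X := (Real.le_log_iff_exp_le hXpos).2 hXl
  have h2 : Real.log X ≤ l := (Real.log_le_iff_le_exp hXpos).2 hXu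
  have h3 : 0 ≤ m * r ^ 2 := by positivity
  rw [hcube, abs_le]
  constructor <;> linarith

end FacetCount

/-- in the sublinear regime (`d → ∞`, `(n-d)/d → 0`), the expected number
of facets satisfies `F = C(n,d)·2^{d-n+1}·exp((n-d)²/(πd) + O((n-d)³/d²) + o(1))`. -/
theorem facet_count_sublinear (d : ℕ → ℕ)
    (hd : ∀ᶠ n in atTop, 2 ≤ d n ∧ d n < n)
    (hdi : Tendsto (fun n : ℕ => (d n : ℝ)) atTop atTop)
    (hreg : Tendsto (fun n : ℕ => ((n : ℝ) - (d n : ℝ)) / (d n : ℝ)) atTop (nhds 0)) :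
    ∃ K : ℝ, 0 < K ∧ ∃ ε : ℕ → ℝ, Tendsto ε atTop (nhds 0) ∧
      ∀ᶠ n : ℕ in atTop,
        |Real.log ((2 : ℝ) ^ ((n : ℝ) - (d n : ℝ) - 1) * FF n (d n) (-1) 1 /
            (n.choose (d n) : ℝ)) -
          ((n : ℝ) - (d n : ℝ)) ^ 2 / (Real.pi * (d n : ℝ))| ≤
        K * ((n : ℝ) - (d n : ℝ)) ^ 3 / (d n : ℝ) ^ 2 + ε n := by
  refine ⟨32, by norm_num, fun n => (((n : ℝ) - d n) / d n) ^ 2 + 32 * (((n : ℝ) - d n) / d n),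
    ?_, ?_⟩
  · simpa using (hreg.pow 2).add (hreg.const_mul 32)
  · filter_upwards [hd, hdi.eventually_ge_atTop 4,
      hreg.eventually_le_const (by norm_num : (0 : ℝ) < 1 / 64)] with n hn h4 hr
    exact FacetCount.abs_log_normalized_FF_sub_le (by exact_mod_cast h4) hn.2 hr
end
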